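/- arXiv:1808.08513 — 4 statements merged into one kernel-verified Lean document; each statement's English description precedes it below -/
import Mathlib

section
/- In a differential category, the deriving transformation d and the coderiving transformation d° satisfy, for every object A, the equality d_A d°_A = (d°_A ⊗ 1_A)(1_{!A} ⊗ σ_{A,A})(d_A ⊗ 1_A) + 1_{!A ⊗ A} as maps !A ⊗ A → !A ⊗ A. -/
universe u v

/-- A symmetric strict monoidal category (data and the coherence axioms that
do not require transport along object equalities). Composition `comp f g`
is in diagrammatic order: first `f`, then `g`. -/
structure SMCData where
  Obj : Type u
  Hom : Obj → Obj → Type v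
  id : ∀ A : Obj, Hom A A
  comp : ∀ {A B C : Obj}, Hom A B → Hom B C → Hom A C
  id_comp : ∀ {A B : Obj} (f : Hom A B), comp (id A) f = f
  comp_id : ∀ {A B : Obj} (f : Hom A B), comp f (id B) = f
  comp_assoc : ∀ {A B C D : Obj} (f : Hom A B) (g : Hom B C) (h : Hom C D),
    comp (comp f g) h = comp f (comp g h)
  ten : Obj → Obj → Obj
  unit : Obj
  tHom : ∀ {A B C D : Obj}, Hom A C → Hom B D → Hom (ten A B) (ten C D)
  tHom_id : ∀ (A B : Obj), tHom (id A) (id B) = id (ten A B)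
  tHom_comp : ∀ {A₁ A₂ A₃ B₁ B₂ B₃ : Obj} (f : Hom A₁ A₂) (g : Hom A₂ A₃)
    (f' : Hom B₁ B₂) (g' : Hom B₂ B₃),
    tHom (comp f g) (comp f' g') = comp (tHom f f') (tHom g g')
  tenAssoc : ∀ (A B C : Obj), ten (ten A B) C = ten A (ten B C)
  unit_ten : ∀ (A : Obj), ten unit A = A
  ten_unit : ∀ (A : Obj), ten A unit = A
  sw : ∀ (A B : Obj), Hom (ten A B) (ten B A)
  sw_natural : ∀ {A B C D : Obj} (f : Hom A C) (g : Hom B D),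
    comp (tHom f g) (sw C D) = comp (sw A B) (tHom g f)
  sw_sw : ∀ (A B : Obj), comp (sw A B) (sw B A) = id (ten A B)

/-- The identity morphism transported along an equality of objects. In a
strict monoidal category the structural isomorphisms are identities, so these
are used to express the strictness identifications. -/
def SMCData.cHom (C : SMCData) {A B : C.Obj} (h : A = B) : C.Hom A B := by
  cases h; exact C.id A
/-- A differential category: an additive symmetric strict monoidal category with a coalgebra modality and a deriving transformation. -/
structure DiffCat extends SMCData where
  -- strictness coherence: associativity and unit identifications are
  -- (transported) identities compatible with the tensor of morphisms,
  -- and the symmetry satisfies the (strict) hexagon identity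
  assoc_natural : ∀ {A₁ A₂ B₁ B₂ C₁ C₂ : Obj} (f : Hom A₁ A₂) (g : Hom B₁ B₂) (h : Hom C₁ C₂),
    comp (tHom (tHom f g) h) (toSMCData.cHom (tenAssoc A₂ B₂ C₂)) =
      comp (toSMCData.cHom (tenAssoc A₁ B₁ C₁)) (tHom f (tHom g h))
  unit_ten_natural : ∀ {A B : Obj} (f : Hom A B),
    comp (tHom (id unit) f) (toSMCData.cHom (unit_ten B)) =
      comp (toSMCData.cHom (unit_ten A)) f
  ten_unit_natural : ∀ {A B : Obj} (f : Hom A B),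
    comp (tHom f (id unit)) (toSMCData.cHom (ten_unit B)) =
      comp (toSMCData.cHom (ten_unit A)) f
  hexagon : ∀ (A B C : Obj),
    comp (toSMCData.cHom (tenAssoc A B C))
      (comp (tHom (id A) (sw B C))
        (comp (toSMCData.cHom (tenAssoc A C B).symm)
          (comp (tHom (sw A C) (id B)) (toSMCData.cHom (tenAssoc C A B))))) =
      sw (ten A B) C
  -- additive enrichment: hom-sets are commutative monoids and composition
  -- and tensor preserve the additive structure
  add : ∀ {A B : Obj}, Hom A B → Hom A B → Hom A B
  zero : ∀ {A B : Obj}, Hom A B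
  add_assoc : ∀ {A B : Obj} (f g h : Hom A B), add (add f g) h = add f (add g h)
  add_comm : ∀ {A B : Obj} (f g : Hom A B), add f g = add g f
  add_zero : ∀ {A B : Obj} (f : Hom A B), add f zero = f
  comp_add : ∀ {A B C : Obj} (f : Hom A B) (g h : Hom B C),
    comp f (add g h) = add (comp f g) (comp f h)
  add_comp : ∀ {A B C : Obj} (f g : Hom A B) (h : Hom B C),
    comp (add f g) h = add (comp f h) (comp g h)
  comp_zero : ∀ {A B C : Obj} (f : Hom A B), comp f (zero : Hom B C) = zero
  zero_comp : ∀ {A B C : Obj} (f : Hom B C), comp (zero : Hom A B) f = zero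
  tHom_add_left : ∀ {A B C D : Obj} (f g : Hom A C) (h : Hom B D),
    tHom (add f g) h = add (tHom f h) (tHom g h)
  tHom_add_right : ∀ {A B C D : Obj} (f : Hom A C) (g h : Hom B D),
    tHom f (add g h) = add (tHom f g) (tHom f h)
  tHom_zero_left : ∀ {A B C D : Obj} (h : Hom B D),
    tHom (zero : Hom A C) h = zero
  tHom_zero_right : ∀ {A B C D : Obj} (f : Hom A C),
    tHom f (zero : Hom B D) = zero
  -- a coalgebra modality: a comonad (bang, rho, eps) with natural
  -- cocommutative comonoid structure (cmul, cunit) on each bang A,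
  -- for which each rho A is a comonoid morphism
  bang : Obj → Obj
  bangMap : ∀ {A B : Obj}, Hom A B → Hom (bang A) (bang B)
  bangMap_id : ∀ (A : Obj), bangMap (id A) = id (bang A)
  bangMap_comp : ∀ {A B C : Obj} (f : Hom A B) (g : Hom B C),
    bangMap (comp f g) = comp (bangMap f) (bangMap g)
  rho : ∀ (A : Obj), Hom (bang A) (bang (bang A))
  eps : ∀ (A : Obj), Hom (bang A) A
  cmul : ∀ (A : Obj), Hom (bang A) (ten (bang A) (bang A))
  cunit : ∀ (A : Obj), Hom (bang A) unit
  rho_natural : ∀ {A B : Obj} (f : Hom A B),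
    comp (bangMap f) (rho B) = comp (rho A) (bangMap (bangMap f))
  eps_natural : ∀ {A B : Obj} (f : Hom A B),
    comp (bangMap f) (eps B) = comp (eps A) f
  cmul_natural : ∀ {A B : Obj} (f : Hom A B),
    comp (bangMap f) (cmul B) = comp (cmul A) (tHom (bangMap f) (bangMap f))
  cunit_natural : ∀ {A B : Obj} (f : Hom A B),
    comp (bangMap f) (cunit B) = cunit A
  rho_eps : ∀ (A : Obj), comp (rho A) (eps (bang A)) = id (bang A)
  rho_bangMap_eps : ∀ (A : Obj), comp (rho A) (bangMap (eps A)) = id (bang A)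
  rho_rho : ∀ (A : Obj), comp (rho A) (rho (bang A)) = comp (rho A) (bangMap (rho A))
  cmul_coassoc : ∀ (A : Obj),
    comp (cmul A) (comp (tHom (cmul A) (id (bang A)))
      (toSMCData.cHom (tenAssoc (bang A) (bang A) (bang A)))) =
    comp (cmul A) (tHom (id (bang A)) (cmul A))
  cmul_counit_left : ∀ (A : Obj),
    comp (cmul A) (comp (tHom (cunit A) (id (bang A)))
      (toSMCData.cHom (unit_ten (bang A)))) = id (bang A)
  cmul_counit_right : ∀ (A : Obj),
    comp (cmul A) (comp (tHom (id (bang A)) (cunit A))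
      (toSMCData.cHom (ten_unit (bang A)))) = id (bang A)
  cmul_cocomm : ∀ (A : Obj), comp (cmul A) (sw (bang A) (bang A)) = cmul A
  rho_cmul : ∀ (A : Obj),
    comp (rho A) (cmul (bang A)) = comp (cmul A) (tHom (rho A) (rho A))
  rho_cunit : ∀ (A : Obj), comp (rho A) (cunit (bang A)) = cunit A
  -- a deriving transformation [d.1]-[d.5]
  der : ∀ (A : Obj), Hom (ten (bang A) A) (bang A)
  der_natural : ∀ {A B : Obj} (f : Hom A B),
    comp (tHom (bangMap f) f) (der B) = comp (der A) (bangMap f)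
  -- [d.1] constant rule
  der_cunit : ∀ (A : Obj), comp (der A) (cunit A) = zero
  -- [d.2] Leibniz rule
  der_cmul : ∀ (A : Obj),
    comp (der A) (cmul A) =
      add
        (comp (tHom (cmul A) (id A))
          (comp (toSMCData.cHom (tenAssoc (bang A) (bang A) A))
            (comp (tHom (id (bang A)) (sw (bang A) A))
              (comp (toSMCData.cHom (tenAssoc (bang A) A (bang A)).symm)
                (tHom (der A) (id (bang A)))))))
        (comp (tHom (cmul A) (id A))
          (comp (toSMCData.cHom (tenAssoc (bang A) (bang A) A))
            (tHom (id (bang A)) (der A))))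
  -- [d.3] linear rule
  der_eps : ∀ (A : Obj),
    comp (der A) (eps A) = comp (tHom (cunit A) (id A)) (toSMCData.cHom (unit_ten A))
  -- [d.4] chain rule
  der_rho : ∀ (A : Obj),
    comp (der A) (rho A) =
      comp (tHom (cmul A) (id A))
        (comp (toSMCData.cHom (tenAssoc (bang A) (bang A) A))
          (comp (tHom (rho A) (der A)) (der (bang A))))
  -- [d.5] interchange rule
  der_interchange : ∀ (A : Obj),
    comp (tHom (der A) (id A)) (der A) =
      comp (toSMCData.cHom (tenAssoc (bang A) A A))
        (comp (tHom (id (bang A)) (sw A A))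
          (comp (toSMCData.cHom (tenAssoc (bang A) A A).symm)
            (comp (tHom (der A) (id A)) (der A))))

def DiffCat.cHom (C : DiffCat) {A B : C.Obj} (h : A = B) : C.Hom A B :=
  C.toSMCData.cHom h

namespace DiffCat

variable (C : DiffCat)

/-- The coderiving transformation d°_A := Δ_A (1 ⊗ ε_A). -/
def dcirc (A : C.Obj) : C.Hom (C.bang A) (C.ten (C.bang A) A) :=
  C.comp (C.cmul A) (C.tHom (C.id (C.bang A)) (C.eps A))

/-- K_A := d°_A d_A + !(0). -/
def K (A : C.Obj) : C.Hom (C.bang A) (C.bang A) :=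
  C.add (C.comp (C.dcirc A) (C.der A)) (C.bangMap (C.zero : C.Hom A A))

/-- J_A := d°_A d_A + 1_{!A}. -/
def J (A : C.Obj) : C.Hom (C.bang A) (C.bang A) :=
  C.add (C.comp (C.dcirc A) (C.der A)) (C.id (C.bang A))

/-- The deriving transformation at the monoidal unit, under the strictness
identification !R ⊗ R = !R. -/
def dR : C.Hom (C.bang C.unit) (C.bang C.unit) :=
  C.comp (C.cHom (C.ten_unit (C.bang C.unit)).symm) (C.der C.unit)

/-- The coderiving transformation at the monoidal unit, under the strictness
identification !R ⊗ R = !R. -/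
def dcircR : C.Hom (C.bang C.unit) (C.bang C.unit) :=
  C.comp (C.dcirc C.unit) (C.cHom (C.ten_unit (C.bang C.unit)))

end DiffCat

namespace SMCData

variable (C : SMCData)

theorem cHom_comp_cHom {A B D : C.Obj} (h : A = B) (k : B = D) :
    C.comp (C.cHom h) (C.cHom k) = C.cHom (h.trans k) := by
  subst h k
  exact C.id_comp _

theorem tHom_id_cHom (A : C.Obj) {B D : C.Obj} (h : B = D) :
    C.tHom (C.id A) (C.cHom h) = C.cHom (congrArg (C.ten A) h) := by
  subst h
  exact C.tHom_id _ _

theorem tHom_cHom_id {A B : C.Obj} (h : A = B) (D : C.Obj) :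
    C.tHom (C.cHom h) (C.id D) = C.cHom (congrArg (C.ten · D) h) := by
  subst h
  exact C.tHom_id _ _

theorem id_tHom_comp (A : C.Obj) {B D E : C.Obj} (f : C.Hom B D) (g : C.Hom D E) :
    C.tHom (C.id A) (C.comp f g) = C.comp (C.tHom (C.id A) f) (C.tHom (C.id A) g) := by
  rw [← C.tHom_comp, C.id_comp]

theorem tHom_id_comp {A B D : C.Obj} (f : C.Hom A B) (g : C.Hom B D) (E : C.Obj) :
    C.tHom (C.comp f g) (C.id E) = C.comp (C.tHom f (C.id E)) (C.tHom g (C.id E)) := by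
  rw [← C.tHom_comp, C.id_comp]

theorem tHom_exchange {A B D E : C.Obj} (f : C.Hom A B) (g : C.Hom D E) :
    C.comp (C.tHom f (C.id D)) (C.tHom (C.id B) g) =
      C.comp (C.tHom (C.id A) g) (C.tHom f (C.id E)) := by
  rw [← C.tHom_comp, ← C.tHom_comp, C.id_comp, C.comp_id, C.id_comp, C.comp_id]

end SMCData

namespace DiffCat

variable (C : DiffCat)

theorem assoc_symm_natural {A₁ A₂ B₁ B₂ D₁ D₂ : C.Obj}
    (f : C.Hom A₁ A₂) (g : C.Hom B₁ B₂) (h : C.Hom D₁ D₂) :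
    C.comp (C.toSMCData.cHom (C.tenAssoc A₁ B₁ D₁).symm) (C.tHom (C.tHom f g) h) =
      C.comp (C.tHom f (C.tHom g h)) (C.toSMCData.cHom (C.tenAssoc A₂ B₂ D₂).symm) := by
  have key := congrArg (fun x => C.comp (C.toSMCData.cHom (C.tenAssoc A₁ B₁ D₁).symm)
    (C.comp x (C.toSMCData.cHom (C.tenAssoc A₂ B₂ D₂).symm))) (C.assoc_natural f g h)
  simp only [C.comp_assoc, C.cHom_comp_cHom] at key
  rw [← C.comp_assoc (C.toSMCData.cHom _) (C.toSMCData.cHom _), C.cHom_comp_cHom] at key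
  simpa only [SMCData.cHom, C.comp_id, C.id_comp] using key

/-- Moving a map `f : B → D` on the middle factor past the interchange of the last two factors
of `(A ⊗ B) ⊗ E`. -/
theorem middle_swap_natural (A E : C.Obj) {B D : C.Obj} (f : C.Hom B D) :
    C.comp (C.toSMCData.cHom (C.tenAssoc A B E))
      (C.comp (C.tHom (C.id A) (C.sw B E))
        (C.comp (C.toSMCData.cHom (C.tenAssoc A E B).symm)
          (C.tHom (C.id (C.ten A E)) f))) =
    C.comp (C.tHom (C.tHom (C.id A) f) (C.id E))
      (C.comp (C.toSMCData.cHom (C.tenAssoc A D E))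
        (C.comp (C.tHom (C.id A) (C.sw D E))
          (C.toSMCData.cHom (C.tenAssoc A E D).symm))) := by
  rw [← C.tHom_id, C.assoc_symm_natural, ← C.comp_assoc (C.tHom _ _) (C.tHom _ _),
    ← C.id_tHom_comp, ← C.sw_natural, C.id_tHom_comp, C.comp_assoc,
    ← C.comp_assoc (C.toSMCData.cHom _), ← C.assoc_natural, C.comp_assoc]

/-- The Leibniz term differentiating the second factor becomes the identity after `ε`. -/
theorem cmul_der_eps (A : C.Obj) :
    C.comp (C.tHom (C.cmul A) (C.id A))
      (C.comp (C.toSMCData.cHom (C.tenAssoc (C.bang A) (C.bang A) A))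
        (C.comp (C.tHom (C.id (C.bang A)) (C.der A)) (C.tHom (C.id (C.bang A)) (C.eps A)))) =
      C.id (C.ten (C.bang A) A) := by
  have key := congrArg (C.tHom · (C.id A)) (C.cmul_counit_right A)
  simp only [C.tHom_id_comp, C.tHom_cHom_id, C.tHom_id] at key
  rw [← C.id_tHom_comp, C.der_eps, C.id_tHom_comp, ← C.comp_assoc (C.toSMCData.cHom _),
    ← C.assoc_natural, C.comp_assoc, C.tHom_id_cHom, C.cHom_comp_cHom]
  exact key

end DiffCat

/-- Proposition 4.1 (Cockett–Lemay): in a differential category,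
d_A d°_A = (d°_A ⊗ 1_A)(1_{!A} ⊗ σ_{A,A})(d_A ⊗ 1_A) + 1_{!A ⊗ A}. -/
theorem statement0 (C : DiffCat) (A : C.Obj) :
    C.comp (C.der A) (C.dcirc A) =
      C.add
        (C.comp (C.tHom (C.dcirc A) (C.id A))
          (C.comp (C.cHom (C.tenAssoc (C.bang A) A A))
            (C.comp (C.tHom (C.id (C.bang A)) (C.sw A A))
              (C.comp (C.cHom (C.tenAssoc (C.bang A) A A).symm)
                (C.tHom (C.der A) (C.id A))))))
        (C.id (C.ten (C.bang A) A)) := by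
  simp only [DiffCat.cHom, DiffCat.dcirc]
  rw [← C.comp_assoc, C.der_cmul, C.add_comp]
  simp only [C.comp_assoc]
  rw [C.cmul_der_eps, C.tHom_exchange, C.tHom_id_comp, C.comp_assoc]
  congr 2
  have key := congrArg (C.comp · (C.tHom (C.der A) (C.id A)))
    (C.middle_swap_natural (C.bang A) A (C.eps A))
  simpa only [C.comp_assoc] using key
end

section
/- For a monoidal coalgebra modality (!, ρ, ε, Δ, e, m, m_R), the coderiving transformation satisfies, for all objects A and B: m_{A,B} d°_{A⊗B} = (d°_A ⊗ d°_B)(1_{!A} ⊗ σ_{A,!B} ⊗ 1_B)(m_{A,B} ⊗ 1_A ⊗ 1_B), and m_R d°_R = m_R (using the strictness identification !R ⊗ R = !R). -/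
universe u v

/-- A symmetric strict monoidal category with a monoidal coalgebra modality. -/
structure LinCat extends SMCData where
  -- strictness coherence: associativity and unit identifications are
  -- (transported) identities compatible with the tensor of morphisms,
  -- and the symmetry satisfies the (strict) hexagon identity
  assoc_natural : ∀ {A₁ A₂ B₁ B₂ C₁ C₂ : Obj} (f : Hom A₁ A₂) (g : Hom B₁ B₂) (h : Hom C₁ C₂),
    comp (tHom (tHom f g) h) (toSMCData.cHom (tenAssoc A₂ B₂ C₂)) =
      comp (toSMCData.cHom (tenAssoc A₁ B₁ C₁)) (tHom f (tHom g h))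
  unit_ten_natural : ∀ {A B : Obj} (f : Hom A B),
    comp (tHom (id unit) f) (toSMCData.cHom (unit_ten B)) =
      comp (toSMCData.cHom (unit_ten A)) f
  ten_unit_natural : ∀ {A B : Obj} (f : Hom A B),
    comp (tHom f (id unit)) (toSMCData.cHom (ten_unit B)) =
      comp (toSMCData.cHom (ten_unit A)) f
  hexagon : ∀ (A B C : Obj),
    comp (toSMCData.cHom (tenAssoc A B C))
      (comp (tHom (id A) (sw B C))
        (comp (toSMCData.cHom (tenAssoc A C B).symm)
          (comp (tHom (sw A C) (id B)) (toSMCData.cHom (tenAssoc C A B))))) =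
      sw (ten A B) C
  -- a coalgebra modality: a comonad (bang, rho, eps) with natural
  -- cocommutative comonoid structure (cmul, cunit) on each bang A,
  -- for which each rho A is a comonoid morphism
  bang : Obj → Obj
  bangMap : ∀ {A B : Obj}, Hom A B → Hom (bang A) (bang B)
  bangMap_id : ∀ (A : Obj), bangMap (id A) = id (bang A)
  bangMap_comp : ∀ {A B C : Obj} (f : Hom A B) (g : Hom B C),
    bangMap (comp f g) = comp (bangMap f) (bangMap g)
  rho : ∀ (A : Obj), Hom (bang A) (bang (bang A))
  eps : ∀ (A : Obj), Hom (bang A) A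
  cmul : ∀ (A : Obj), Hom (bang A) (ten (bang A) (bang A))
  cunit : ∀ (A : Obj), Hom (bang A) unit
  rho_natural : ∀ {A B : Obj} (f : Hom A B),
    comp (bangMap f) (rho B) = comp (rho A) (bangMap (bangMap f))
  eps_natural : ∀ {A B : Obj} (f : Hom A B),
    comp (bangMap f) (eps B) = comp (eps A) f
  cmul_natural : ∀ {A B : Obj} (f : Hom A B),
    comp (bangMap f) (cmul B) = comp (cmul A) (tHom (bangMap f) (bangMap f))
  cunit_natural : ∀ {A B : Obj} (f : Hom A B),
    comp (bangMap f) (cunit B) = cunit A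
  rho_eps : ∀ (A : Obj), comp (rho A) (eps (bang A)) = id (bang A)
  rho_bangMap_eps : ∀ (A : Obj), comp (rho A) (bangMap (eps A)) = id (bang A)
  rho_rho : ∀ (A : Obj), comp (rho A) (rho (bang A)) = comp (rho A) (bangMap (rho A))
  cmul_coassoc : ∀ (A : Obj),
    comp (cmul A) (comp (tHom (cmul A) (id (bang A)))
      (toSMCData.cHom (tenAssoc (bang A) (bang A) (bang A)))) =
    comp (cmul A) (tHom (id (bang A)) (cmul A))
  cmul_counit_left : ∀ (A : Obj),
    comp (cmul A) (comp (tHom (cunit A) (id (bang A)))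
      (toSMCData.cHom (unit_ten (bang A)))) = id (bang A)
  cmul_counit_right : ∀ (A : Obj),
    comp (cmul A) (comp (tHom (id (bang A)) (cunit A))
      (toSMCData.cHom (ten_unit (bang A)))) = id (bang A)
  cmul_cocomm : ∀ (A : Obj), comp (cmul A) (sw (bang A) (bang A)) = cmul A
  rho_cmul : ∀ (A : Obj),
    comp (rho A) (cmul (bang A)) = comp (cmul A) (tHom (rho A) (rho A))
  rho_cunit : ∀ (A : Obj), comp (rho A) (cunit (bang A)) = cunit A
  -- monoidal coalgebra modality structure: (bang, m, mUnit) is a symmetric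
  -- monoidal functor, rho, eps, cmul, cunit are monoidal transformations and
  -- cmul, cunit are bang-coalgebra morphisms
  m : ∀ (A B : Obj), Hom (ten (bang A) (bang B)) (bang (ten A B))
  mUnit : Hom unit (bang unit)
  m_natural : ∀ {A A' B B' : Obj} (f : Hom A A') (g : Hom B B'),
    comp (tHom (bangMap f) (bangMap g)) (m A' B') = comp (m A B) (bangMap (tHom f g))
  m_assoc : ∀ (A B C : Obj),
    comp (tHom (m A B) (id (bang C)))
      (comp (m (ten A B) C) (bangMap (toSMCData.cHom (tenAssoc A B C)))) =
    comp (toSMCData.cHom (tenAssoc (bang A) (bang B) (bang C)))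
      (comp (tHom (id (bang A)) (m B C)) (m A (ten B C)))
  m_unit_left : ∀ (A : Obj),
    comp (toSMCData.cHom (unit_ten (bang A)).symm)
      (comp (tHom mUnit (id (bang A)))
        (comp (m unit A) (bangMap (toSMCData.cHom (unit_ten A))))) = id (bang A)
  m_unit_right : ∀ (A : Obj),
    comp (toSMCData.cHom (ten_unit (bang A)).symm)
      (comp (tHom (id (bang A)) mUnit)
        (comp (m A unit) (bangMap (toSMCData.cHom (ten_unit A))))) = id (bang A)
  m_sw : ∀ (A B : Obj),
    comp (sw (bang A) (bang B)) (m B A) = comp (m A B) (bangMap (sw A B))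
  m_rho : ∀ (A B : Obj),
    comp (m A B) (rho (ten A B)) =
      comp (tHom (rho A) (rho B)) (comp (m (bang A) (bang B)) (bangMap (m A B)))
  mUnit_rho : comp mUnit (rho unit) = comp mUnit (bangMap mUnit)
  m_eps : ∀ (A B : Obj), comp (m A B) (eps (ten A B)) = tHom (eps A) (eps B)
  mUnit_eps : comp mUnit (eps unit) = id unit
  m_cmul : ∀ (A B : Obj),
    comp (m A B) (cmul (ten A B)) =
      comp (tHom (cmul A) (cmul B))
        (comp (toSMCData.cHom (tenAssoc (bang A) (bang A) (ten (bang B) (bang B))))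
          (comp (tHom (id (bang A)) (toSMCData.cHom (tenAssoc (bang A) (bang B) (bang B)).symm))
            (comp (tHom (id (bang A)) (tHom (sw (bang A) (bang B)) (id (bang B))))
              (comp (tHom (id (bang A)) (toSMCData.cHom (tenAssoc (bang B) (bang A) (bang B))))
                (comp (toSMCData.cHom (tenAssoc (bang A) (bang B) (ten (bang A) (bang B))).symm)
                  (tHom (m A B) (m A B)))))))
  m_cunit : ∀ (A B : Obj),
    comp (m A B) (cunit (ten A B)) =
      comp (tHom (cunit A) (cunit B)) (toSMCData.cHom (unit_ten unit))
  mUnit_cmul : comp mUnit (cmul unit) =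
    comp (toSMCData.cHom (unit_ten unit).symm) (tHom mUnit mUnit)
  mUnit_cunit : comp mUnit (cunit unit) = id unit
  cmul_coalg : ∀ (A : Obj),
    comp (rho A) (bangMap (cmul A)) =
      comp (cmul A) (comp (tHom (rho A) (rho A)) (m (bang A) (bang A)))
  cunit_coalg : ∀ (A : Obj),
    comp (rho A) (bangMap (cunit A)) = comp (cunit A) mUnit

def LinCat.cHom (C : LinCat) {A B : C.Obj} (h : A = B) : C.Hom A B :=
  C.toSMCData.cHom h

namespace LinCat

variable (C : LinCat)

/-- The coderiving transformation d°_A := Δ_A (1 ⊗ ε_A). -/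
def dcirc (A : C.Obj) : C.Hom (C.bang A) (C.ten (C.bang A) A) :=
  C.comp (C.cmul A) (C.tHom (C.id (C.bang A)) (C.eps A))

/-- The coderiving transformation at the monoidal unit, under the strictness
identification !R ⊗ R = !R. -/
def dcircR : C.Hom (C.bang C.unit) (C.bang C.unit) :=
  C.comp (C.dcirc C.unit) (C.cHom (C.ten_unit (C.bang C.unit)))

end LinCat

namespace LinCat

theorem cHom_trans (C : LinCat) {X Y Z : C.Obj} (h : X = Y) (k : Y = Z) :
    C.comp (C.cHom h) (C.cHom k) = C.cHom (h.trans k) := by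
  subst h
  exact C.id_comp _

theorem cHom_self (C : LinCat) {X : C.Obj} (h : X = X) : C.cHom h = C.id X := rfl

theorem assoc_symm_natural (C : LinCat) {A₁ A₂ B₁ B₂ C₁ C₂ : C.Obj}
    (f : C.Hom A₁ A₂) (g : C.Hom B₁ B₂) (h : C.Hom C₁ C₂) :
    C.comp (C.tHom f (C.tHom g h)) (C.cHom (C.tenAssoc A₂ B₂ C₂).symm) =
      C.comp (C.cHom (C.tenAssoc A₁ B₁ C₁).symm) (C.tHom (C.tHom f g) h) := by
  have key : C.comp (C.tHom (C.tHom f g) h) (C.cHom (C.tenAssoc A₂ B₂ C₂)) =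
      C.comp (C.cHom (C.tenAssoc A₁ B₁ C₁)) (C.tHom f (C.tHom g h)) :=
    C.assoc_natural f g h
  calc _ = C.comp (C.comp (C.cHom (C.tenAssoc A₁ B₁ C₁).symm)
          (C.comp (C.cHom (C.tenAssoc A₁ B₁ C₁)) (C.tHom f (C.tHom g h))))
          (C.cHom (C.tenAssoc A₂ B₂ C₂).symm) := by
        rw [← C.comp_assoc (C.cHom _) (C.cHom _), cHom_trans, cHom_self, C.id_comp]
    _ = _ := by
        rw [← key, C.comp_assoc, C.comp_assoc, cHom_trans, cHom_self, C.comp_id]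

/-- The middle-four interchange `(W ⊗ X) ⊗ (Y ⊗ Z) → (W ⊗ Y) ⊗ (X ⊗ Z)`. -/
def interchange (C : LinCat) (W X Y Z : C.Obj) :
    C.Hom (C.ten (C.ten W X) (C.ten Y Z)) (C.ten (C.ten W Y) (C.ten X Z)) :=
  C.comp (C.cHom (C.tenAssoc W X (C.ten Y Z)))
    (C.comp (C.tHom (C.id W) (C.cHom (C.tenAssoc X Y Z).symm))
      (C.comp (C.tHom (C.id W) (C.tHom (C.sw X Y) (C.id Z)))
        (C.comp (C.tHom (C.id W) (C.cHom (C.tenAssoc Y X Z)))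
          (C.cHom (C.tenAssoc W Y (C.ten X Z)).symm))))

/-- Naturality squares paste. -/
theorem square_comp (C : LinCat) {X₁ X₂ Y₁ Y₂ Z₁ Z₂ : C.Obj}
    {a : C.Hom X₁ X₂} {b : C.Hom Y₁ Y₂} {c : C.Hom Z₁ Z₂}
    {p₁ : C.Hom X₁ Y₁} {p₂ : C.Hom X₂ Y₂} {q₁ : C.Hom Y₁ Z₁} {q₂ : C.Hom Y₂ Z₂}
    (hp : C.comp a p₂ = C.comp p₁ b) (hq : C.comp b q₂ = C.comp q₁ c) :
    C.comp a (C.comp p₂ q₂) = C.comp (C.comp p₁ q₁) c := by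
  rw [← C.comp_assoc, hp, C.comp_assoc, hq, C.comp_assoc]

/-- Tensoring a naturality square on the left with a morphism. -/
theorem square_tHom_left (C : LinCat) {W₁ W₂ X₁ X₂ Y₁ Y₂ : C.Obj} (f : C.Hom W₁ W₂)
    {a : C.Hom X₁ X₂} {b : C.Hom Y₁ Y₂} {p₁ : C.Hom X₁ Y₁} {p₂ : C.Hom X₂ Y₂}
    (hp : C.comp a p₂ = C.comp p₁ b) :
    C.comp (C.tHom f a) (C.tHom (C.id W₂) p₂) =
      C.comp (C.tHom (C.id W₁) p₁) (C.tHom f b) := by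
  rw [← C.tHom_comp, ← C.tHom_comp, hp, C.comp_id, C.id_comp]

theorem interchange_natural (C : LinCat) {W₁ W₂ X₁ X₂ Y₁ Y₂ Z₁ Z₂ : C.Obj}
    (f : C.Hom W₁ W₂) (g : C.Hom X₁ X₂) (h : C.Hom Y₁ Y₂) (k : C.Hom Z₁ Z₂) :
    C.comp (C.tHom (C.tHom f g) (C.tHom h k)) (C.interchange W₂ X₂ Y₂ Z₂) =
      C.comp (C.interchange W₁ X₁ Y₁ Z₁) (C.tHom (C.tHom f h) (C.tHom g k)) := by
  have hsw : C.comp (C.tHom (C.tHom g h) k) (C.tHom (C.sw X₂ Y₂) (C.id Z₂)) =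
      C.comp (C.tHom (C.sw X₁ Y₁) (C.id Z₁)) (C.tHom (C.tHom h g) k) := by
    rw [← C.tHom_comp, ← C.tHom_comp, C.sw_natural, C.comp_id, C.id_comp]
  exact C.square_comp (C.assoc_natural f g (C.tHom h k))
    (C.square_comp (C.square_tHom_left f (C.assoc_symm_natural g h k))
      (C.square_comp (C.square_tHom_left f hsw)
        (C.square_comp (C.square_tHom_left f (C.assoc_natural h g k))
          (C.assoc_symm_natural f h (C.tHom g k)))))

theorem m_cmul_interchange (C : LinCat) (A B : C.Obj) :
    C.comp (C.m A B) (C.cmul (C.ten A B)) =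
      C.comp (C.tHom (C.cmul A) (C.cmul B))
        (C.comp (C.interchange (C.bang A) (C.bang A) (C.bang B) (C.bang B))
          (C.tHom (C.m A B) (C.m A B))) := by
  simp only [interchange, C.comp_assoc]
  exact C.m_cmul A B

theorem m_dcirc (C : LinCat) (A B : C.Obj) :
    C.comp (C.m A B) (C.dcirc (C.ten A B)) =
      C.comp (C.tHom (C.dcirc A) (C.dcirc B))
        (C.comp (C.interchange (C.bang A) A (C.bang B) B)
          (C.tHom (C.m A B) (C.id (C.ten A B)))) := by
  have hm : C.comp (C.tHom (C.m A B) (C.m A B))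
        (C.tHom (C.id (C.bang (C.ten A B))) (C.eps (C.ten A B))) =
      C.comp (C.tHom (C.tHom (C.id (C.bang A)) (C.id (C.bang B)))
          (C.tHom (C.eps A) (C.eps B)))
        (C.tHom (C.m A B) (C.id (C.ten A B))) := by
    rw [← C.tHom_comp, ← C.tHom_comp, C.m_eps, C.tHom_id, C.comp_id, C.comp_id, C.id_comp]
  unfold dcirc
  rw [C.tHom_comp, ← C.comp_assoc, m_cmul_interchange]
  simp only [C.comp_assoc]
  rw [hm, ← C.comp_assoc (C.interchange _ _ _ _), ← interchange_natural, C.comp_assoc]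

theorem mUnit_dcircR (C : LinCat) : C.comp C.mUnit C.dcircR = C.mUnit := by
  have hm : C.comp (C.tHom C.mUnit C.mUnit) (C.tHom (C.id (C.bang C.unit)) (C.eps C.unit)) =
      C.tHom C.mUnit (C.id C.unit) := by
    rw [← C.tHom_comp, C.mUnit_eps, C.comp_id]
  have hunit : C.comp (C.tHom C.mUnit (C.id C.unit)) (C.cHom (C.ten_unit (C.bang C.unit))) =
      C.comp (C.cHom (C.ten_unit C.unit)) C.mUnit := C.ten_unit_natural C.mUnit
  have hcmul : C.comp C.mUnit (C.cmul C.unit) =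
      C.comp (C.cHom (C.unit_ten C.unit).symm) (C.tHom C.mUnit C.mUnit) := C.mUnit_cmul
  unfold dcircR dcirc
  rw [← C.comp_assoc, ← C.comp_assoc, hcmul, C.comp_assoc (C.cHom _), hm, C.comp_assoc, hunit,
    ← C.comp_assoc, cHom_trans, cHom_self, C.id_comp]

end LinCat

/-- Proposition 2.2 (Cockett–Lemay): compatibility of the coderiving
transformation with a monoidal coalgebra modality. -/
theorem statement3 (C : LinCat) :
    (∀ A B : C.Obj,
      C.comp (C.m A B) (C.dcirc (C.ten A B)) =
        C.comp (C.tHom (C.dcirc A) (C.dcirc B))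
          (C.comp (C.cHom (C.tenAssoc (C.bang A) A (C.ten (C.bang B) B)))
            (C.comp (C.tHom (C.id (C.bang A)) (C.cHom (C.tenAssoc A (C.bang B) B).symm))
              (C.comp (C.tHom (C.id (C.bang A)) (C.tHom (C.sw A (C.bang B)) (C.id B)))
                (C.comp (C.tHom (C.id (C.bang A)) (C.cHom (C.tenAssoc (C.bang B) A B)))
                  (C.comp (C.cHom (C.tenAssoc (C.bang A) (C.bang B) (C.ten A B)).symm)
                    (C.tHom (C.m A B) (C.tHom (C.id A) (C.id B))))))))) ∧
    (C.comp C.mUnit C.dcircR = C.mUnit) := by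
  refine ⟨fun A B => ?_, C.mUnit_dcircR⟩
  rw [C.m_dcirc, C.tHom_id]
  simp only [LinCat.interchange, C.comp_assoc]
end

section
/- In a differential linear category, for all objects A and B the following equalities hold: (K_A ⊗ 1_{!B}) m_{A,B} = m_{A,B} K_{A⊗B} = (1_{!A} ⊗ K_B) m_{A,B}, and (J_A ⊗ 1_{!B}) m_{A,B} = m_{A,B} J_{A⊗B} = (1_{!A} ⊗ J_B) m_{A,B}. -/
universe u v

/-- A differential linear category: a differential category whose coalgebra modality is a monoidal coalgebra modality. -/
structure DiffLinCat extends SMCData where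
  -- strictness coherence: associativity and unit identifications are
  -- (transported) identities compatible with the tensor of morphisms,
  -- and the symmetry satisfies the (strict) hexagon identity
  assoc_natural : ∀ {A₁ A₂ B₁ B₂ C₁ C₂ : Obj} (f : Hom A₁ A₂) (g : Hom B₁ B₂) (h : Hom C₁ C₂),
    comp (tHom (tHom f g) h) (toSMCData.cHom (tenAssoc A₂ B₂ C₂)) =
      comp (toSMCData.cHom (tenAssoc A₁ B₁ C₁)) (tHom f (tHom g h))
  unit_ten_natural : ∀ {A B : Obj} (f : Hom A B),
    comp (tHom (id unit) f) (toSMCData.cHom (unit_ten B)) =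
      comp (toSMCData.cHom (unit_ten A)) f
  ten_unit_natural : ∀ {A B : Obj} (f : Hom A B),
    comp (tHom f (id unit)) (toSMCData.cHom (ten_unit B)) =
      comp (toSMCData.cHom (ten_unit A)) f
  hexagon : ∀ (A B C : Obj),
    comp (toSMCData.cHom (tenAssoc A B C))
      (comp (tHom (id A) (sw B C))
        (comp (toSMCData.cHom (tenAssoc A C B).symm)
          (comp (tHom (sw A C) (id B)) (toSMCData.cHom (tenAssoc C A B))))) =
      sw (ten A B) C
  -- additive enrichment: hom-sets are commutative monoids and composition
  -- and tensor preserve the additive structure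
  add : ∀ {A B : Obj}, Hom A B → Hom A B → Hom A B
  zero : ∀ {A B : Obj}, Hom A B
  add_assoc : ∀ {A B : Obj} (f g h : Hom A B), add (add f g) h = add f (add g h)
  add_comm : ∀ {A B : Obj} (f g : Hom A B), add f g = add g f
  add_zero : ∀ {A B : Obj} (f : Hom A B), add f zero = f
  comp_add : ∀ {A B C : Obj} (f : Hom A B) (g h : Hom B C),
    comp f (add g h) = add (comp f g) (comp f h)
  add_comp : ∀ {A B C : Obj} (f g : Hom A B) (h : Hom B C),
    comp (add f g) h = add (comp f h) (comp g h)
  comp_zero : ∀ {A B C : Obj} (f : Hom A B), comp f (zero : Hom B C) = zero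
  zero_comp : ∀ {A B C : Obj} (f : Hom B C), comp (zero : Hom A B) f = zero
  tHom_add_left : ∀ {A B C D : Obj} (f g : Hom A C) (h : Hom B D),
    tHom (add f g) h = add (tHom f h) (tHom g h)
  tHom_add_right : ∀ {A B C D : Obj} (f : Hom A C) (g h : Hom B D),
    tHom f (add g h) = add (tHom f g) (tHom f h)
  tHom_zero_left : ∀ {A B C D : Obj} (h : Hom B D),
    tHom (zero : Hom A C) h = zero
  tHom_zero_right : ∀ {A B C D : Obj} (f : Hom A C),
    tHom f (zero : Hom B D) = zero
  -- a coalgebra modality: a comonad (bang, rho, eps) with natural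
  -- cocommutative comonoid structure (cmul, cunit) on each bang A,
  -- for which each rho A is a comonoid morphism
  bang : Obj → Obj
  bangMap : ∀ {A B : Obj}, Hom A B → Hom (bang A) (bang B)
  bangMap_id : ∀ (A : Obj), bangMap (id A) = id (bang A)
  bangMap_comp : ∀ {A B C : Obj} (f : Hom A B) (g : Hom B C),
    bangMap (comp f g) = comp (bangMap f) (bangMap g)
  rho : ∀ (A : Obj), Hom (bang A) (bang (bang A))
  eps : ∀ (A : Obj), Hom (bang A) A
  cmul : ∀ (A : Obj), Hom (bang A) (ten (bang A) (bang A))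
  cunit : ∀ (A : Obj), Hom (bang A) unit
  rho_natural : ∀ {A B : Obj} (f : Hom A B),
    comp (bangMap f) (rho B) = comp (rho A) (bangMap (bangMap f))
  eps_natural : ∀ {A B : Obj} (f : Hom A B),
    comp (bangMap f) (eps B) = comp (eps A) f
  cmul_natural : ∀ {A B : Obj} (f : Hom A B),
    comp (bangMap f) (cmul B) = comp (cmul A) (tHom (bangMap f) (bangMap f))
  cunit_natural : ∀ {A B : Obj} (f : Hom A B),
    comp (bangMap f) (cunit B) = cunit A
  rho_eps : ∀ (A : Obj), comp (rho A) (eps (bang A)) = id (bang A)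
  rho_bangMap_eps : ∀ (A : Obj), comp (rho A) (bangMap (eps A)) = id (bang A)
  rho_rho : ∀ (A : Obj), comp (rho A) (rho (bang A)) = comp (rho A) (bangMap (rho A))
  cmul_coassoc : ∀ (A : Obj),
    comp (cmul A) (comp (tHom (cmul A) (id (bang A)))
      (toSMCData.cHom (tenAssoc (bang A) (bang A) (bang A)))) =
    comp (cmul A) (tHom (id (bang A)) (cmul A))
  cmul_counit_left : ∀ (A : Obj),
    comp (cmul A) (comp (tHom (cunit A) (id (bang A)))
      (toSMCData.cHom (unit_ten (bang A)))) = id (bang A)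
  cmul_counit_right : ∀ (A : Obj),
    comp (cmul A) (comp (tHom (id (bang A)) (cunit A))
      (toSMCData.cHom (ten_unit (bang A)))) = id (bang A)
  cmul_cocomm : ∀ (A : Obj), comp (cmul A) (sw (bang A) (bang A)) = cmul A
  rho_cmul : ∀ (A : Obj),
    comp (rho A) (cmul (bang A)) = comp (cmul A) (tHom (rho A) (rho A))
  rho_cunit : ∀ (A : Obj), comp (rho A) (cunit (bang A)) = cunit A
  -- a deriving transformation [d.1]-[d.5]
  der : ∀ (A : Obj), Hom (ten (bang A) A) (bang A)
  der_natural : ∀ {A B : Obj} (f : Hom A B),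
    comp (tHom (bangMap f) f) (der B) = comp (der A) (bangMap f)
  -- [d.1] constant rule
  der_cunit : ∀ (A : Obj), comp (der A) (cunit A) = zero
  -- [d.2] Leibniz rule
  der_cmul : ∀ (A : Obj),
    comp (der A) (cmul A) =
      add
        (comp (tHom (cmul A) (id A))
          (comp (toSMCData.cHom (tenAssoc (bang A) (bang A) A))
            (comp (tHom (id (bang A)) (sw (bang A) A))
              (comp (toSMCData.cHom (tenAssoc (bang A) A (bang A)).symm)
                (tHom (der A) (id (bang A)))))))
        (comp (tHom (cmul A) (id A))
          (comp (toSMCData.cHom (tenAssoc (bang A) (bang A) A))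
            (tHom (id (bang A)) (der A))))
  -- [d.3] linear rule
  der_eps : ∀ (A : Obj),
    comp (der A) (eps A) = comp (tHom (cunit A) (id A)) (toSMCData.cHom (unit_ten A))
  -- [d.4] chain rule
  der_rho : ∀ (A : Obj),
    comp (der A) (rho A) =
      comp (tHom (cmul A) (id A))
        (comp (toSMCData.cHom (tenAssoc (bang A) (bang A) A))
          (comp (tHom (rho A) (der A)) (der (bang A))))
  -- [d.5] interchange rule
  der_interchange : ∀ (A : Obj),
    comp (tHom (der A) (id A)) (der A) =
      comp (toSMCData.cHom (tenAssoc (bang A) A A))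
        (comp (tHom (id (bang A)) (sw A A))
          (comp (toSMCData.cHom (tenAssoc (bang A) A A).symm)
            (comp (tHom (der A) (id A)) (der A))))
  -- monoidal coalgebra modality structure: (bang, m, mUnit) is a symmetric
  -- monoidal functor, rho, eps, cmul, cunit are monoidal transformations and
  -- cmul, cunit are bang-coalgebra morphisms
  m : ∀ (A B : Obj), Hom (ten (bang A) (bang B)) (bang (ten A B))
  mUnit : Hom unit (bang unit)
  m_natural : ∀ {A A' B B' : Obj} (f : Hom A A') (g : Hom B B'),
    comp (tHom (bangMap f) (bangMap g)) (m A' B') = comp (m A B) (bangMap (tHom f g))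
  m_assoc : ∀ (A B C : Obj),
    comp (tHom (m A B) (id (bang C)))
      (comp (m (ten A B) C) (bangMap (toSMCData.cHom (tenAssoc A B C)))) =
    comp (toSMCData.cHom (tenAssoc (bang A) (bang B) (bang C)))
      (comp (tHom (id (bang A)) (m B C)) (m A (ten B C)))
  m_unit_left : ∀ (A : Obj),
    comp (toSMCData.cHom (unit_ten (bang A)).symm)
      (comp (tHom mUnit (id (bang A)))
        (comp (m unit A) (bangMap (toSMCData.cHom (unit_ten A))))) = id (bang A)
  m_unit_right : ∀ (A : Obj),
    comp (toSMCData.cHom (ten_unit (bang A)).symm)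
      (comp (tHom (id (bang A)) mUnit)
        (comp (m A unit) (bangMap (toSMCData.cHom (ten_unit A))))) = id (bang A)
  m_sw : ∀ (A B : Obj),
    comp (sw (bang A) (bang B)) (m B A) = comp (m A B) (bangMap (sw A B))
  m_rho : ∀ (A B : Obj),
    comp (m A B) (rho (ten A B)) =
      comp (tHom (rho A) (rho B)) (comp (m (bang A) (bang B)) (bangMap (m A B)))
  mUnit_rho : comp mUnit (rho unit) = comp mUnit (bangMap mUnit)
  m_eps : ∀ (A B : Obj), comp (m A B) (eps (ten A B)) = tHom (eps A) (eps B)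
  mUnit_eps : comp mUnit (eps unit) = id unit
  m_cmul : ∀ (A B : Obj),
    comp (m A B) (cmul (ten A B)) =
      comp (tHom (cmul A) (cmul B))
        (comp (toSMCData.cHom (tenAssoc (bang A) (bang A) (ten (bang B) (bang B))))
          (comp (tHom (id (bang A)) (toSMCData.cHom (tenAssoc (bang A) (bang B) (bang B)).symm))
            (comp (tHom (id (bang A)) (tHom (sw (bang A) (bang B)) (id (bang B))))
              (comp (tHom (id (bang A)) (toSMCData.cHom (tenAssoc (bang B) (bang A) (bang B))))
                (comp (toSMCData.cHom (tenAssoc (bang A) (bang B) (ten (bang A) (bang B))).symm)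
                  (tHom (m A B) (m A B)))))))
  m_cunit : ∀ (A B : Obj),
    comp (m A B) (cunit (ten A B)) =
      comp (tHom (cunit A) (cunit B)) (toSMCData.cHom (unit_ten unit))
  mUnit_cmul : comp mUnit (cmul unit) =
    comp (toSMCData.cHom (unit_ten unit).symm) (tHom mUnit mUnit)
  mUnit_cunit : comp mUnit (cunit unit) = id unit
  cmul_coalg : ∀ (A : Obj),
    comp (rho A) (bangMap (cmul A)) =
      comp (cmul A) (comp (tHom (rho A) (rho A)) (m (bang A) (bang A)))
  cunit_coalg : ∀ (A : Obj),
    comp (rho A) (bangMap (cunit A)) = comp (cunit A) mUnit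

def DiffLinCat.cHom (C : DiffLinCat) {A B : C.Obj} (h : A = B) : C.Hom A B :=
  C.toSMCData.cHom h

namespace DiffLinCat

variable (C : DiffLinCat)

/-- The coderiving transformation d°_A := Δ_A (1 ⊗ ε_A). -/
def dcirc (A : C.Obj) : C.Hom (C.bang A) (C.ten (C.bang A) A) :=
  C.comp (C.cmul A) (C.tHom (C.id (C.bang A)) (C.eps A))

/-- K_A := d°_A d_A + !(0). -/
def K (A : C.Obj) : C.Hom (C.bang A) (C.bang A) :=
  C.add (C.comp (C.dcirc A) (C.der A)) (C.bangMap (C.zero : C.Hom A A))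

/-- J_A := d°_A d_A + 1_{!A}. -/
def J (A : C.Obj) : C.Hom (C.bang A) (C.bang A) :=
  C.add (C.comp (C.dcirc A) (C.der A)) (C.id (C.bang A))

/-- The deriving transformation at the monoidal unit, under the strictness
identification !R ⊗ R = !R. -/
def dR : C.Hom (C.bang C.unit) (C.bang C.unit) :=
  C.comp (C.cHom (C.ten_unit (C.bang C.unit)).symm) (C.der C.unit)

/-- The coderiving transformation at the monoidal unit, under the strictness
identification !R ⊗ R = !R. -/
def dcircR : C.Hom (C.bang C.unit) (C.bang C.unit) :=
  C.comp (C.dcirc C.unit) (C.cHom (C.ten_unit (C.bang C.unit)))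

end DiffLinCat

namespace DiffLinCat

section

variable {C : DiffLinCat}

local notation:80 f:81 "⨟" g:80 => SMCData.comp _ f g
local notation:90 f:91 "⊠" g:90 => SMCData.tHom _ f g

/-! ### Strictness identifications -/

theorem tHom_comp_tHom {A₁ A₂ A₃ B₁ B₂ B₃ : C.Obj} (f : C.Hom A₁ A₂) (f' : C.Hom B₁ B₂)
    (g : C.Hom A₂ A₃) (g' : C.Hom B₂ B₃) :
    (f ⊠ f') ⨟ (g ⊠ g') = (f ⨟ g) ⊠ (f' ⨟ g') :=
  (C.tHom_comp f g f' g').symm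

theorem tHom_comp_tHom_assoc {A₁ A₂ A₃ B₁ B₂ B₃ X : C.Obj} (f : C.Hom A₁ A₂)
    (f' : C.Hom B₁ B₂) (g : C.Hom A₂ A₃) (g' : C.Hom B₂ B₃) (k : C.Hom (C.ten A₃ B₃) X) :
    (f ⊠ f') ⨟ (g ⊠ g') ⨟ k = ((f ⨟ g) ⊠ (f' ⨟ g')) ⨟ k := by
  rw [← C.comp_assoc, tHom_comp_tHom]

theorem comp_congr_assoc {X Y Y' Z W : C.Obj} {f : C.Hom X Y} {g : C.Hom Y Z}
    {f' : C.Hom X Y'} {g' : C.Hom Y' Z} (h : f ⨟ g = f' ⨟ g') (k : C.Hom Z W) :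
    f ⨟ g ⨟ k = f' ⨟ g' ⨟ k := by
  rw [← C.comp_assoc, h, C.comp_assoc]

theorem cHom_self {A : C.Obj} (h : A = A) : C.toSMCData.cHom h = C.id A := rfl

theorem cHom_comp_cHom {A B D : C.Obj} (h : A = B) (h' : B = D) :
    C.toSMCData.cHom h ⨟ C.toSMCData.cHom h' = C.toSMCData.cHom (h.trans h') := by
  subst h h'
  exact C.id_comp _

theorem cHom_comp_cHom_assoc {A B D X : C.Obj} (h : A = B) (h' : B = D) (k : C.Hom D X) :
    C.toSMCData.cHom h ⨟ C.toSMCData.cHom h' ⨟ k = C.toSMCData.cHom (h.trans h') ⨟ k := by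
  rw [← C.comp_assoc, cHom_comp_cHom]

theorem id_tHom_cHom {A D E : C.Obj} (h : D = E) :
    C.id A ⊠ C.toSMCData.cHom h = C.toSMCData.cHom (congrArg (C.ten A) h) := by
  subst h
  exact C.tHom_id _ _

theorem assoc_symm_natural {A₁ A₂ B₁ B₂ C₁ C₂ : C.Obj} (f : C.Hom A₁ A₂) (g : C.Hom B₁ B₂)
    (h : C.Hom C₁ C₂) :
    (f ⊠ g ⊠ h) ⨟ C.toSMCData.cHom (C.tenAssoc A₂ B₂ C₂).symm =
      C.toSMCData.cHom (C.tenAssoc A₁ B₁ C₁).symm ⨟ ((f ⊠ g) ⊠ h) := by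
  have key := C.assoc_natural f g h
  calc _ = C.toSMCData.cHom (C.tenAssoc A₁ B₁ C₁).symm ⨟
        (C.toSMCData.cHom (C.tenAssoc A₁ B₁ C₁) ⨟ (f ⊠ g ⊠ h)) ⨟
          C.toSMCData.cHom (C.tenAssoc A₂ B₂ C₂).symm := by
        rw [C.comp_assoc, cHom_comp_cHom_assoc, cHom_self, C.id_comp]
    _ = _ := by
        rw [← key, C.comp_assoc, cHom_comp_cHom, cHom_self, C.comp_id]

theorem sw_unit_unit : C.sw C.unit C.unit = C.id (C.ten C.unit C.unit) := by
  have hm : (C.mUnit ⊠ C.mUnit) ⨟ C.sw (C.bang C.unit) (C.bang C.unit) =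
      C.mUnit ⊠ C.mUnit := by
    have h : C.mUnit ⊠ C.mUnit =
        C.toSMCData.cHom (C.unit_ten C.unit) ⨟ C.mUnit ⨟ C.cmul C.unit := by
      rw [C.mUnit_cmul, cHom_comp_cHom_assoc, cHom_self, C.id_comp]
    rw [h, C.comp_assoc, C.comp_assoc, C.cmul_cocomm]
  have h := congrArg (fun k => k ⨟ (C.cunit C.unit ⊠ C.cunit C.unit)) hm
  simpa only [C.sw_natural, C.comp_assoc, tHom_comp_tHom, C.mUnit_cunit, C.tHom_id,
    C.comp_id] using h

/-! ### The middle-four interchange -/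

/-- The interchange `(A ⊗ B) ⊗ (D ⊗ E) → (A ⊗ D) ⊗ (B ⊗ E)` of the two middle factors. -/
def interchange (A B D E : C.Obj) :
    C.Hom (C.ten (C.ten A B) (C.ten D E)) (C.ten (C.ten A D) (C.ten B E)) :=
  C.toSMCData.cHom (C.tenAssoc A B (C.ten D E)) ⨟
    (C.id A ⊠ C.toSMCData.cHom (C.tenAssoc B D E).symm) ⨟
      (C.id A ⊠ C.sw B D ⊠ C.id E) ⨟
        (C.id A ⊠ C.toSMCData.cHom (C.tenAssoc D B E)) ⨟
          C.toSMCData.cHom (C.tenAssoc A D (C.ten B E)).symm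

theorem interchange_natural {A A' B B' D D' E E' : C.Obj} (f : C.Hom A A') (g : C.Hom B B')
    (h : C.Hom D D') (k : C.Hom E E') :
    ((f ⊠ g) ⊠ h ⊠ k) ⨟ interchange A' B' D' E' =
      interchange A B D E ⨟ ((f ⊠ h) ⊠ g ⊠ k) := by
  unfold interchange
  simp only [C.comp_assoc]
  rw [← assoc_symm_natural, comp_congr_assoc (C.assoc_natural _ _ _)]
  simp only [tHom_comp_tHom_assoc, C.comp_id, C.id_comp]
  rw [← C.assoc_natural, comp_congr_assoc (assoc_symm_natural _ _ _), tHom_comp_tHom_assoc,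
    tHom_comp_tHom_assoc, C.sw_natural, C.comp_id, C.id_comp]

theorem interchange_unit_unit (A B : C.Obj) :
    interchange A C.unit C.unit B = C.id _ := by
  unfold interchange
  simp only [sw_unit_unit, C.tHom_id, C.id_comp, id_tHom_cHom, cHom_comp_cHom, cHom_self]

/-! ### Derivatives along comonoid morphisms -/

section Comonoid

variable {N Z : C.Obj} {δ : C.Hom N (C.ten N N)} {φ : C.Hom N (C.bang Z)}

theorem coassoc_of_retract {ψ : C.Hom (C.bang Z) N} (hψ : φ ⨟ ψ = C.id N)
    (hφ : φ ⨟ C.cmul Z = δ ⨟ (φ ⊠ φ)) :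
    δ ⨟ (δ ⊠ C.id N) ⨟ C.toSMCData.cHom (C.tenAssoc N N N) = δ ⨟ (C.id N ⊠ δ) := by
  have hL : δ ⨟ (δ ⊠ C.id N) ⨟ C.toSMCData.cHom (C.tenAssoc N N N) ⨟ (φ ⊠ φ ⊠ φ) =
      δ ⨟ (C.id N ⊠ δ) ⨟ (φ ⊠ φ ⊠ φ) := by
    have h := congrArg (fun k => φ ⨟ k) (C.cmul_coassoc Z)
    rw [comp_congr_assoc hφ, comp_congr_assoc hφ, tHom_comp_tHom_assoc, tHom_comp_tHom, hφ,
      C.comp_id] at h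
    rw [← C.assoc_natural, tHom_comp_tHom_assoc, tHom_comp_tHom, C.id_comp, h]
  have h := congrArg (fun k => k ⨟ (ψ ⊠ ψ ⊠ ψ)) hL
  simpa only [C.comp_assoc, tHom_comp_tHom, hψ, C.tHom_id, C.comp_id] using h

theorem cocomm_of_retract {ψ : C.Hom (C.bang Z) N} (hψ : φ ⨟ ψ = C.id N)
    (hφ : φ ⨟ C.cmul Z = δ ⨟ (φ ⊠ φ)) : δ ⨟ C.sw N N = δ := by
  have hL : (δ ⨟ C.sw N N) ⨟ (φ ⊠ φ) = δ ⨟ (φ ⊠ φ) := by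
    rw [C.comp_assoc, ← C.sw_natural, ← C.comp_assoc, ← hφ, C.comp_assoc, C.cmul_cocomm]
  have h := congrArg (fun k => k ⨟ (ψ ⊠ ψ)) hL
  simpa only [C.comp_assoc, tHom_comp_tHom, hψ, C.tHom_id, C.comp_id] using h

/-- The chain rule for the derivative at a comonoid morphism `φ` in direction `w`. -/
theorem directional_rho
    (hδ : δ ⨟ (δ ⊠ C.id N) ⨟ C.toSMCData.cHom (C.tenAssoc N N N) = δ ⨟ (C.id N ⊠ δ))
    (hφ : φ ⨟ C.cmul Z = δ ⨟ (φ ⊠ φ)) (w : C.Hom N Z) :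
    (δ ⨟ (φ ⊠ w) ⨟ C.der Z) ⨟ C.rho Z =
      δ ⨟ ((φ ⨟ C.rho Z) ⊠ (δ ⨟ (φ ⊠ w) ⨟ C.der Z)) ⨟ C.der (C.bang Z) := by
  have h : (φ ⊠ w) ⨟ (C.cmul Z ⊠ C.id Z) = (δ ⊠ C.id N) ⨟ ((φ ⊠ φ) ⊠ w) := by
    rw [tHom_comp_tHom, tHom_comp_tHom, hφ, C.comp_id, C.id_comp]
  simp only [C.comp_assoc, C.der_rho]
  rw [comp_congr_assoc h, comp_congr_assoc (C.assoc_natural _ _ _), tHom_comp_tHom_assoc]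
  have h' := congrArg (fun k => k ⨟ ((φ ⨟ C.rho Z) ⊠ ((φ ⊠ w) ⨟ C.der Z)) ⨟ C.der _) hδ
  simp only [C.comp_assoc, tHom_comp_tHom_assoc, C.id_comp] at h' ⊢
  exact h'

/-- The Leibniz rule for the derivative at a comonoid morphism `φ` in direction `w`. -/
theorem directional_cmul
    (hδ : δ ⨟ (δ ⊠ C.id N) ⨟ C.toSMCData.cHom (C.tenAssoc N N N) = δ ⨟ (C.id N ⊠ δ))
    (hσ : δ ⨟ C.sw N N = δ) (hφ : φ ⨟ C.cmul Z = δ ⨟ (φ ⊠ φ)) (w : C.Hom N Z) :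
    (δ ⨟ (φ ⊠ w) ⨟ C.der Z) ⨟ C.cmul Z =
      C.add (δ ⨟ ((δ ⨟ (φ ⊠ w) ⨟ C.der Z) ⊠ φ)) (δ ⨟ (φ ⊠ (δ ⨟ (φ ⊠ w) ⨟ C.der Z))) := by
  have h : (φ ⊠ w) ⨟ (C.cmul Z ⊠ C.id Z) = (δ ⊠ C.id N) ⨟ ((φ ⊠ φ) ⊠ w) := by
    rw [tHom_comp_tHom, tHom_comp_tHom, hφ, C.comp_id, C.id_comp]
  have hδ' {X : C.Obj} (k : C.Hom (C.ten N (C.ten N N)) X) :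
      δ ⨟ (δ ⊠ C.id N) ⨟ C.toSMCData.cHom (C.tenAssoc N N N) ⨟ k = δ ⨟ (C.id N ⊠ δ) ⨟ k := by
    have h' := congrArg (fun l => l ⨟ k) hδ
    simpa only [C.comp_assoc] using h'
  have hδ'' : δ ⨟ (C.id N ⊠ δ) ⨟ C.toSMCData.cHom (C.tenAssoc N N N).symm =
      δ ⨟ (δ ⊠ C.id N) := by
    rw [← hδ', cHom_comp_cHom, cHom_self, C.comp_id]
  simp only [C.comp_assoc, C.der_cmul, C.comp_add]
  rw [comp_congr_assoc h, comp_congr_assoc h, comp_congr_assoc (C.assoc_natural _ _ _),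
    comp_congr_assoc (C.assoc_natural _ _ _), hδ', hδ']
  congr 1
  · have hsw : (C.id N ⊠ δ) ⨟ (φ ⊠ φ ⊠ w) ⨟ (C.id (C.bang Z) ⊠ C.sw (C.bang Z) Z) =
        (C.id N ⊠ δ) ⨟ (φ ⊠ w ⊠ φ) := by
      simp only [tHom_comp_tHom, C.sw_natural, C.id_comp, C.comp_id]
      rw [← C.comp_assoc δ, hσ]
    have h' := congrArg (fun l => l ⨟ ((φ ⊠ w) ⊠ φ) ⨟ (C.der Z ⊠ C.id _)) hδ''
    simp only [C.comp_assoc] at h'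
    rw [← comp_congr_assoc (assoc_symm_natural _ _ _)] at h'
    calc _ = δ ⨟ ((C.id N ⊠ δ) ⨟ (φ ⊠ φ ⊠ w) ⨟ (C.id (C.bang Z) ⊠ C.sw (C.bang Z) Z)) ⨟
          C.toSMCData.cHom (C.tenAssoc (C.bang Z) Z (C.bang Z)).symm ⨟
            (C.der Z ⊠ C.id (C.bang Z)) := by simp only [C.comp_assoc]
      _ = _ := by
        rw [hsw, C.comp_assoc, h']
        simp only [tHom_comp_tHom, C.id_comp, C.comp_id]
  · simp only [tHom_comp_tHom, C.id_comp, C.comp_id]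

end Comonoid

/-! ### The comonoid `!A ⊗ !B` -/

/-- The comultiplication of `!A ⊗ !B`. -/
def cmulTen (A B : C.Obj) : C.Hom (C.ten (C.bang A) (C.bang B))
    (C.ten (C.ten (C.bang A) (C.bang B)) (C.ten (C.bang A) (C.bang B))) :=
  (C.cmul A ⊠ C.cmul B) ⨟ interchange _ _ _ _

/-- The `!`-coalgebra structure of `!A ⊗ !B`. -/
def coalgTen (A B : C.Obj) : C.Hom (C.ten (C.bang A) (C.bang B))
    (C.bang (C.ten (C.bang A) (C.bang B))) :=
  (C.rho A ⊠ C.rho B) ⨟ C.m (C.bang A) (C.bang B)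

theorem m_cmul_eq_cmulTen (A B : C.Obj) :
    C.m A B ⨟ C.cmul (C.ten A B) = cmulTen A B ⨟ (C.m A B ⊠ C.m A B) := by
  simp only [C.m_cmul, cmulTen, interchange, C.comp_assoc]

theorem coalgTen_eps (A B : C.Obj) : coalgTen A B ⨟ C.eps _ = C.id _ := by
  rw [coalgTen, C.comp_assoc, C.m_eps, tHom_comp_tHom, C.rho_eps, C.rho_eps, C.tHom_id]

theorem coalgTen_cmul (A B : C.Obj) :
    coalgTen A B ⨟ C.cmul _ = cmulTen A B ⨟ (coalgTen A B ⊠ coalgTen A B) := by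
  unfold coalgTen
  rw [C.comp_assoc, m_cmul_eq_cmulTen, cmulTen, cmulTen, C.comp_assoc, tHom_comp_tHom_assoc,
    C.rho_cmul, C.rho_cmul, ← tHom_comp_tHom_assoc,
    comp_congr_assoc (interchange_natural _ _ _ _), tHom_comp_tHom, C.comp_assoc]

/-- The projection `ε ⊗ e : !A ⊗ !B → A`. -/
def linFst (A B : C.Obj) : C.Hom (C.ten (C.bang A) (C.bang B)) A :=
  (C.eps A ⊠ C.cunit B) ⨟ C.toSMCData.cHom (C.ten_unit A)

/-- The projection `e ⊗ ε : !A ⊗ !B → B`. -/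
def linSnd (A B : C.Obj) : C.Hom (C.ten (C.bang A) (C.bang B)) B :=
  (C.cunit A ⊠ C.eps B) ⨟ C.toSMCData.cHom (C.unit_ten B)

theorem coalgTen_linFst (A B : C.Obj) :
    coalgTen A B ⨟ C.bangMap (linFst A B) =
      (C.id (C.bang A) ⊠ C.cunit B) ⨟ C.toSMCData.cHom (C.ten_unit (C.bang A)) := by
  have h : (C.id (C.bang A) ⊠ C.mUnit) ⨟ C.m A C.unit ⨟
      C.bangMap (C.toSMCData.cHom (C.ten_unit A)) =
        C.toSMCData.cHom (C.ten_unit (C.bang A)) := by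
    have h := congrArg (fun k => C.toSMCData.cHom (C.ten_unit (C.bang A)) ⨟ k)
      (C.m_unit_right A)
    simpa only [cHom_comp_cHom_assoc, cHom_self, C.id_comp, C.comp_id] using h
  rw [coalgTen, linFst, C.bangMap_comp, C.comp_assoc, ← comp_congr_assoc (C.m_natural _ _),
    tHom_comp_tHom_assoc, C.rho_bangMap_eps, C.cunit_coalg, ← h, tHom_comp_tHom_assoc, C.id_comp]

theorem coalgTen_linSnd (A B : C.Obj) :
    coalgTen A B ⨟ C.bangMap (linSnd A B) =
      (C.cunit A ⊠ C.id (C.bang B)) ⨟ C.toSMCData.cHom (C.unit_ten (C.bang B)) := by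
  have h : (C.mUnit ⊠ C.id (C.bang B)) ⨟ C.m C.unit B ⨟
      C.bangMap (C.toSMCData.cHom (C.unit_ten B)) =
        C.toSMCData.cHom (C.unit_ten (C.bang B)) := by
    have h := congrArg (fun k => C.toSMCData.cHom (C.unit_ten (C.bang B)) ⨟ k)
      (C.m_unit_left B)
    simpa only [cHom_comp_cHom_assoc, cHom_self, C.id_comp, C.comp_id] using h
  rw [coalgTen, linSnd, C.bangMap_comp, C.comp_assoc, ← comp_congr_assoc (C.m_natural _ _),
    tHom_comp_tHom_assoc, C.rho_bangMap_eps, C.cunit_coalg, ← h, tHom_comp_tHom_assoc, C.id_comp]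

/-- The two projections of the comonoid `!A ⊗ !B` are jointly a pairing. -/
theorem cmulTen_projections (A B : C.Obj) :
    cmulTen A B ⨟ ((coalgTen A B ⨟ C.bangMap (linFst A B)) ⊠
      (coalgTen A B ⨟ C.bangMap (linSnd A B))) = C.id _ := by
  rw [coalgTen_linFst, coalgTen_linSnd, cmulTen, ← tHom_comp_tHom, C.comp_assoc,
    ← comp_congr_assoc (interchange_natural _ _ _ _), interchange_unit_unit, C.id_comp,
    tHom_comp_tHom, tHom_comp_tHom, C.cmul_counit_right, C.cmul_counit_left, C.tHom_id]

theorem coalgTen_bangMap_eps {A B X : C.Obj} (p : C.Hom (C.ten (C.bang A) (C.bang B)) X) :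
    (coalgTen A B ⨟ C.bangMap p) ⨟ C.eps X = p := by
  rw [C.comp_assoc, C.eps_natural, ← C.comp_assoc, coalgTen_eps, C.id_comp]

theorem coalgTen_bangMap_cmul {A B X : C.Obj} (p : C.Hom (C.ten (C.bang A) (C.bang B)) X) :
    (coalgTen A B ⨟ C.bangMap p) ⨟ C.cmul X =
      cmulTen A B ⨟ ((coalgTen A B ⨟ C.bangMap p) ⊠ (coalgTen A B ⨟ C.bangMap p)) := by
  rw [C.comp_assoc, C.cmul_natural, ← C.comp_assoc, coalgTen_cmul, C.comp_assoc, tHom_comp_tHom]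

/-! ### The operator `d° d` -/

/-- The operator `d° d : !A → !A`. -/
def dcircDer (A : C.Obj) : C.Hom (C.bang A) (C.bang A) := C.dcirc A ⨟ C.der A

theorem dcircDer_cunit (A : C.Obj) : dcircDer A ⨟ C.cunit A = C.zero := by
  rw [dcircDer, C.comp_assoc, C.der_cunit, C.comp_zero]

theorem dcircDer_eps (A : C.Obj) : dcircDer A ⨟ C.eps A = C.eps A := by
  rw [dcircDer, dcirc, C.comp_assoc, C.der_eps, C.comp_assoc, tHom_comp_tHom_assoc, C.id_comp,
    C.comp_id]
  have h : C.cunit A ⊠ C.eps A =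
      (C.cunit A ⊠ C.id (C.bang A)) ⨟ (C.id C.unit ⊠ C.eps A) := by
    rw [tHom_comp_tHom, C.comp_id, C.id_comp]
  have h' := congrArg (fun k => k ⨟ C.eps A) (C.cmul_counit_left A)
  rw [h, C.comp_assoc, C.unit_ten_natural]
  simpa only [C.comp_assoc, C.id_comp] using h'

theorem dcircDer_natural {A B : C.Obj} (f : C.Hom A B) :
    C.bangMap f ⨟ dcircDer B = dcircDer A ⨟ C.bangMap f := by
  rw [dcircDer, dcircDer, dcirc, dcirc, C.comp_assoc, C.comp_assoc, C.comp_assoc,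
    comp_congr_assoc (C.cmul_natural f), tHom_comp_tHom_assoc, C.eps_natural, C.comp_id,
    ← C.der_natural, tHom_comp_tHom_assoc, C.id_comp]

/-- `!`-maps out of `!Z` given by pairing two linear maps. -/
theorem cmul_bangMap_m {Z X Y : C.Obj} (p : C.Hom Z X) (q : C.Hom Z Y) :
    C.cmul Z ⨟ (C.bangMap p ⊠ C.bangMap q) ⨟ C.m X Y =
      C.rho Z ⨟ C.bangMap (C.cmul Z ⨟ (C.bangMap p ⊠ C.bangMap q) ⨟ (C.eps X ⊠ C.eps Y)) := by
  rw [tHom_comp_tHom, C.eps_natural, C.eps_natural, C.bangMap_comp, ← C.comp_assoc (C.rho Z),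
    C.cmul_coalg, C.comp_assoc, C.comp_assoc, ← C.m_natural, tHom_comp_tHom_assoc, C.bangMap_comp,
    C.bangMap_comp, ← C.comp_assoc (C.rho Z), ← C.comp_assoc (C.rho Z), C.rho_bangMap_eps,
    C.id_comp, C.id_comp]

theorem dcircDer_tHom_id_m (A B : C.Obj) :
    (dcircDer A ⊠ C.id (C.bang B)) ⨟ C.m A B = C.m A B ⨟ dcircDer (C.ten A B) := by
  have hφ := coalgTen_cmul A B
  have hδ := coassoc_of_retract (coalgTen_eps A B) hφ
  have hσ := cocomm_of_retract (coalgTen_eps A B) hφ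
  obtain ⟨t, ht⟩ : ∃ t, t = cmulTen A B ⨟
    (coalgTen A B ⊠ (dcircDer A ⊠ C.id (C.bang B))) ⨟ C.der _ := ⟨_, rfl⟩
  have hleib := directional_cmul hδ hσ hφ (dcircDer A ⊠ C.id (C.bang B))
  have hchain := directional_rho hδ hφ (dcircDer A ⊠ C.id (C.bang B))
  rw [← ht] at hleib hchain
  have hfst : t ⨟ C.bangMap (linFst A B) =
      (coalgTen A B ⨟ C.bangMap (linFst A B)) ⨟ dcircDer A := by
    have hw : (dcircDer A ⊠ C.id (C.bang B)) ⨟ linFst A B = linFst A B := by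
      rw [linFst, tHom_comp_tHom_assoc, dcircDer_eps, C.id_comp]
    rw [ht, C.comp_assoc, C.comp_assoc, ← C.der_natural, tHom_comp_tHom_assoc, hw, dcircDer, dcirc,
      C.comp_assoc (C.cmul A), ← C.comp_assoc _ (C.cmul A), coalgTen_bangMap_cmul, C.comp_assoc,
      tHom_comp_tHom_assoc, coalgTen_bangMap_eps, C.comp_id]
  have hsnd : t ⨟ C.bangMap (linSnd A B) = C.zero := by
    have hw : (dcircDer A ⊠ C.id (C.bang B)) ⨟ linSnd A B = C.zero := by
      rw [linSnd, tHom_comp_tHom_assoc, dcircDer_cunit, C.tHom_zero_left, C.zero_comp]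
    rw [ht, C.comp_assoc, C.comp_assoc, ← C.der_natural, tHom_comp_tHom_assoc, hw,
      C.tHom_zero_right, C.zero_comp, C.comp_zero]
  have ht_pair : t ⨟ C.cmul _ ⨟ (C.bangMap (linFst A B) ⊠ C.bangMap (linSnd A B)) =
      dcircDer A ⊠ C.id (C.bang B) := by
    rw [← C.comp_assoc, hleib, C.add_comp, C.comp_assoc, C.comp_assoc, tHom_comp_tHom,
      tHom_comp_tHom, hfst, hsnd, C.tHom_zero_right, C.comp_zero, C.add_zero]
    have h := congrArg (fun k => k ⨟ (dcircDer A ⊠ C.id (C.bang B))) (cmulTen_projections A B)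
    simpa only [C.comp_assoc, tHom_comp_tHom, C.comp_id, C.id_comp] using h
  have hφ_pair : coalgTen A B ⨟ C.cmul _ ⨟
      (C.bangMap (linFst A B) ⊠ C.bangMap (linSnd A B)) = C.id _ := by
    rw [← C.comp_assoc, hφ, C.comp_assoc, tHom_comp_tHom, cmulTen_projections]
  have hm := cmul_bangMap_m (linFst A B) (linSnd A B)
  obtain ⟨q, hq⟩ : ∃ q, q = C.cmul _ ⨟ (C.bangMap (linFst A B) ⊠ C.bangMap (linSnd A B)) ⨟
    (C.eps A ⊠ C.eps B) := ⟨_, rfl⟩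
  rw [← hq] at hm
  have hφq : (coalgTen A B ⨟ C.rho _) ⨟ C.bangMap q = C.m A B := by
    rw [C.comp_assoc, ← hm]
    have h := congrArg (fun k => k ⨟ C.m A B) hφ_pair
    simpa only [C.comp_assoc, C.id_comp] using h
  have htq : t ⨟ q = C.m A B ⨟ C.eps _ := by
    have h := congrArg (fun k => k ⨟ (C.eps A ⊠ C.eps B)) ht_pair
    simp only [C.comp_assoc, tHom_comp_tHom, dcircDer_eps, C.id_comp] at h
    simp only [tHom_comp_tHom] at hq
    rw [C.m_eps, hq, h]
  calc _ = t ⨟ C.rho _ ⨟ C.bangMap q := by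
        rw [← ht_pair, ← hm]
        simp only [C.comp_assoc]
    _ = cmulTen A B ⨟ (C.m A B ⊠ (C.m A B ⨟ C.eps _)) ⨟ C.der _ := by
        rw [← C.comp_assoc, hchain, C.comp_assoc, C.comp_assoc, ← C.der_natural,
          tHom_comp_tHom_assoc, hφq, htq]
    _ = _ := by
        rw [dcircDer, dcirc, C.comp_assoc, comp_congr_assoc (m_cmul_eq_cmulTen A B),
          tHom_comp_tHom_assoc, C.comp_id]

theorem id_tHom_dcircDer_m (A B : C.Obj) :
    (C.id (C.bang A) ⊠ dcircDer B) ⨟ C.m A B = C.m A B ⨟ dcircDer (C.ten A B) := by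
  have hm : C.m A B = C.sw _ _ ⨟ C.m B A ⨟ C.bangMap (C.sw B A) := by
    rw [← C.m_sw, ← C.comp_assoc, C.sw_sw, C.id_comp]
  rw [hm, ← C.comp_assoc, C.sw_natural, C.comp_assoc, C.comp_assoc, C.comp_assoc,
    dcircDer_natural, comp_congr_assoc (dcircDer_tHom_id_m B A)]

end

end DiffLinCat

/-- Proposition 4.5 (Cockett–Lemay): K and J are compatible with the
monoidal structure of the modality. -/
theorem statement4 (C : DiffLinCat) (A B : C.Obj) :
    (C.comp (C.tHom (C.K A) (C.id (C.bang B))) (C.m A B) =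
      C.comp (C.m A B) (C.K (C.ten A B))) ∧
    (C.comp (C.m A B) (C.K (C.ten A B)) =
      C.comp (C.tHom (C.id (C.bang A)) (C.K B)) (C.m A B)) ∧
    (C.comp (C.tHom (C.J A) (C.id (C.bang B))) (C.m A B) =
      C.comp (C.m A B) (C.J (C.ten A B))) ∧
    (C.comp (C.m A B) (C.J (C.ten A B)) =
      C.comp (C.tHom (C.id (C.bang A)) (C.J B)) (C.m A B)) := by
  have hL := DiffLinCat.dcircDer_tHom_id_m A B
  have hR := DiffLinCat.id_tHom_dcircDer_m A B
  have hL0 := C.m_natural (C.zero : C.Hom A A) (C.id B)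
  have hR0 := C.m_natural (C.id A) (C.zero : C.Hom B B)
  rw [C.bangMap_id, C.tHom_zero_left] at hL0
  rw [C.bangMap_id, C.tHom_zero_right] at hR0
  unfold DiffLinCat.dcircDer at hL hR
  simp only [DiffLinCat.K, DiffLinCat.J, C.tHom_add_left, C.tHom_add_right, C.add_comp,
    C.comp_add, hL, hR, hL0, hR0, C.tHom_id, C.id_comp, C.comp_id, and_self]
end

section
/- For a differential category, the following are equivalent: (i) K is a natural isomorphism; (ii) J is a natural isomorphism and the deriving transformation d is Taylor. -/
universe u v

namespace DiffCat

local infixr:80 "⋆" => SMCData.comp _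
local infixr:85 "⊠" => SMCData.tHom _
local infixl:65 "⨢" => DiffCat.add _

variable (C : DiffCat)

/-! ### Transported identities -/

theorem cHom_rfl (A : C.Obj) : C.toSMCData.cHom (rfl : A = A) = C.id A := rfl

theorem cHom_comp_cHom {A B D : C.Obj} (h : A = B) (k : B = D) :
    C.toSMCData.cHom h ⋆ C.toSMCData.cHom k = C.toSMCData.cHom (h.trans k) := by
  subst h k
  exact C.id_comp _

theorem id_tHom_cHom (X : C.Obj) {A B : C.Obj} (h : A = B) :
    C.id X ⊠ C.toSMCData.cHom h = C.toSMCData.cHom (congrArg (C.ten X) h) := by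
  subst h
  exact C.tHom_id _ _

theorem cHom_tHom_id (X : C.Obj) {A B : C.Obj} (h : A = B) :
    C.toSMCData.cHom h ⊠ C.id X = C.toSMCData.cHom (congrArg (C.ten · X) h) := by
  subst h
  exact C.tHom_id _ _

theorem assoc_inv_natural {A₁ A₂ B₁ B₂ D₁ D₂ : C.Obj} (f : C.Hom A₁ A₂) (g : C.Hom B₁ B₂)
    (h : C.Hom D₁ D₂) :
    (f ⊠ (g ⊠ h)) ⋆ C.toSMCData.cHom (C.tenAssoc A₂ B₂ D₂).symm =
      C.toSMCData.cHom (C.tenAssoc A₁ B₁ D₁).symm ⋆ ((f ⊠ g) ⊠ h) := by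
  rw [← C.comp_id (_ ⋆ ((f ⊠ g) ⊠ h)), ← C.cHom_rfl,
    ← C.cHom_comp_cHom (C.tenAssoc A₂ B₂ D₂) (C.tenAssoc A₂ B₂ D₂).symm, ← C.comp_assoc,
    C.comp_assoc (C.toSMCData.cHom _) _ (C.toSMCData.cHom _), C.assoc_natural, ← C.comp_assoc,
    C.cHom_comp_cHom, C.cHom_rfl, C.id_comp]

/-! ### Exchanging the last two tensor factors -/

/-- The isomorphism `(X ⊗ A) ⊗ B → (X ⊗ B) ⊗ A` exchanging the last two factors. -/
def exch (X A B : C.Obj) : C.Hom (C.ten (C.ten X A) B) (C.ten (C.ten X B) A) :=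
  C.toSMCData.cHom (C.tenAssoc X A B) ⋆ (C.id X ⊠ C.sw A B) ⋆
    C.toSMCData.cHom (C.tenAssoc X B A).symm

theorem exch_natural {X Y A A' B B' : C.Obj} (f : C.Hom X Y) (g : C.Hom A A') (h : C.Hom B B') :
    ((f ⊠ g) ⊠ h) ⋆ C.exch Y A' B' = C.exch X A B ⋆ ((f ⊠ h) ⊠ g) := by
  unfold exch
  rw [← C.comp_assoc, C.assoc_natural, C.comp_assoc, C.comp_assoc, C.comp_assoc,
    ← C.assoc_inv_natural, ← C.comp_assoc (f ⊠ _), ← C.comp_assoc (C.id X ⊠ _),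
    ← C.tHom_comp, ← C.tHom_comp, C.sw_natural, C.comp_id, C.id_comp]

theorem der_interchange_exch (A : C.Obj) :
    C.exch (C.bang A) A A ⋆ (C.der A ⊠ C.id A) ⋆ C.der A = (C.der A ⊠ C.id A) ⋆ C.der A := by
  unfold exch
  rw [C.comp_assoc, C.comp_assoc]
  exact (C.der_interchange A).symm

theorem cmul_cmul_exch (A : C.Obj) :
    C.cmul A ⋆ (C.cmul A ⊠ C.id (C.bang A)) ⋆ C.exch (C.bang A) (C.bang A) (C.bang A) =
      C.cmul A ⋆ (C.cmul A ⊠ C.id (C.bang A)) := by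
  have h := C.cmul_coassoc A
  rw [← C.comp_assoc] at h
  unfold exch
  rw [← C.comp_assoc, ← C.comp_assoc, h, C.comp_assoc, ← C.comp_assoc (C.id _ ⊠ C.cmul A),
    ← C.tHom_comp, C.cmul_cocomm, C.id_comp, ← C.comp_assoc, ← h, C.comp_assoc,
    C.cHom_comp_cHom, C.cHom_rfl, C.comp_id]

/-! ### The coderiving transformation -/

theorem dcirc_natural {A B : C.Obj} (f : C.Hom A B) :
    C.bangMap f ⋆ C.dcirc B = C.dcirc A ⋆ (C.bangMap f ⊠ f) := by
  unfold dcirc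
  rw [← C.comp_assoc, C.cmul_natural, C.comp_assoc, C.comp_assoc, ← C.tHom_comp, ← C.tHom_comp,
    C.eps_natural, C.comp_id, C.id_comp]

theorem dcirc_dcirc_exch (A : C.Obj) :
    C.dcirc A ⋆ (C.dcirc A ⊠ C.id A) ⋆ C.exch (C.bang A) A A =
      C.dcirc A ⋆ (C.dcirc A ⊠ C.id A) := by
  have h : C.dcirc A ⋆ (C.dcirc A ⊠ C.id A) =
      (C.cmul A ⋆ (C.cmul A ⊠ C.id (C.bang A))) ⋆ ((C.id (C.bang A) ⊠ C.eps A) ⊠ C.eps A) := by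
    unfold dcirc
    rw [C.comp_assoc, C.comp_assoc, ← C.tHom_comp, ← C.tHom_comp, C.id_comp, C.id_comp,
      C.comp_id]
  rw [← C.comp_assoc, h, C.comp_assoc, C.exch_natural, ← C.comp_assoc, C.comp_assoc (C.cmul A),
    C.cmul_cmul_exch]

theorem der_dcirc (A : C.Obj) :
    C.der A ⋆ C.dcirc A =
      ((C.dcirc A ⊠ C.id A) ⋆ C.exch (C.bang A) A A ⋆ (C.der A ⊠ C.id A)) ⨢
        C.id (C.ten (C.bang A) A) := by
  have hfst : ((C.cmul A ⊠ C.id A) ⋆ C.exch (C.bang A) (C.bang A) A ⋆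
      (C.der A ⊠ C.id (C.bang A))) ⋆ (C.id (C.bang A) ⊠ C.eps A) =
      (C.dcirc A ⊠ C.id A) ⋆ C.exch (C.bang A) A A ⋆ (C.der A ⊠ C.id A) := by
    have hd : C.dcirc A ⊠ C.id A =
        (C.cmul A ⊠ C.id A) ⋆ ((C.id (C.bang A) ⊠ C.eps A) ⊠ C.id A) := by
      rw [← C.tHom_comp, C.comp_id]; rfl
    rw [hd, C.comp_assoc, C.comp_assoc, C.comp_assoc, ← C.comp_assoc _ (C.exch _ A A),
      C.exch_natural, C.comp_assoc, ← C.tHom_comp, ← C.tHom_comp, C.comp_id, C.id_comp,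
      C.tHom_id, C.id_comp, C.comp_id]
  have hsnd : ((C.cmul A ⊠ C.id A) ⋆ C.toSMCData.cHom (C.tenAssoc (C.bang A) (C.bang A) A) ⋆
      (C.id (C.bang A) ⊠ C.der A)) ⋆ (C.id (C.bang A) ⊠ C.eps A) =
      C.id (C.ten (C.bang A) A) := by
    have hu : (C.cmul A ⋆ (C.id (C.bang A) ⊠ C.cunit A) ⋆
        C.toSMCData.cHom (C.ten_unit (C.bang A))) ⊠ (C.id A ⋆ C.id A ⋆ C.id A) =
        C.id (C.ten (C.bang A) A) := by
      rw [C.cmul_counit_right, C.id_comp, C.id_comp, C.tHom_id]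
    rw [C.tHom_comp, C.tHom_comp, C.cHom_tHom_id] at hu
    rw [C.comp_assoc, C.comp_assoc, ← C.tHom_comp, C.der_eps, C.tHom_comp,
      ← C.comp_assoc (C.toSMCData.cHom _), ← C.assoc_natural, C.comp_assoc, C.id_tHom_cHom,
      C.cHom_comp_cHom]
    exact hu
  rw [← hfst, ← hsnd, ← C.add_comp]
  unfold dcirc exch
  rw [← C.comp_assoc, C.der_cmul]
  simp only [C.comp_assoc]

/-! ### Linear vector fields -/

/-- The derivation `d° (1 ⊗ w) d` of `!A` induced by an endomorphism `w` of `A`. -/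
def linField {A : C.Obj} (w : C.Hom A A) : C.Hom (C.bang A) (C.bang A) :=
  C.dcirc A ⋆ (C.id (C.bang A) ⊠ w) ⋆ C.der A

/-- The Euler operator `d° d`. -/
def euler (A : C.Obj) : C.Hom (C.bang A) (C.bang A) := C.dcirc A ⋆ C.der A

theorem linField_id (A : C.Obj) : C.linField (C.id A) = C.euler A := by
  unfold linField euler
  rw [C.tHom_id, C.id_comp]

theorem der_linField {A : C.Obj} (w : C.Hom A A) :
    C.der A ⋆ C.linField w =
      ((C.linField w ⊠ C.id A) ⋆ C.der A) ⨢ ((C.id (C.bang A) ⊠ w) ⋆ C.der A) := by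
  have hw : (C.der A ⊠ C.id A) ⋆ (C.id (C.bang A) ⊠ w) =
      ((C.id (C.bang A) ⊠ C.id A) ⊠ w) ⋆ (C.der A ⊠ C.id A) := by
    rw [← C.tHom_comp, ← C.tHom_comp, C.tHom_id, C.comp_id, C.comp_id, C.id_comp, C.id_comp]
  have hd : C.linField w ⊠ C.id A =
      (C.dcirc A ⊠ C.id A) ⋆ ((C.id (C.bang A) ⊠ w) ⊠ C.id A) ⋆ (C.der A ⊠ C.id A) := by
    rw [← C.tHom_comp, ← C.tHom_comp, C.comp_id, C.comp_id]; rfl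
  conv_lhs => unfold linField
  rw [← C.comp_assoc, C.der_dcirc, C.add_comp, C.id_comp, hd]
  congr 1
  rw [C.comp_assoc, C.comp_assoc, ← C.comp_assoc (C.der A ⊠ C.id A), hw, C.comp_assoc,
    ← C.comp_assoc (C.exch _ _ _), ← C.exch_natural, C.comp_assoc, C.der_interchange_exch,
    C.comp_assoc, C.comp_assoc]

theorem linField_dcirc {A : C.Obj} (w : C.Hom A A) :
    C.linField w ⋆ C.dcirc A =
      (C.dcirc A ⋆ (C.linField w ⊠ C.id A)) ⨢ (C.dcirc A ⋆ (C.id (C.bang A) ⊠ w)) := by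
  have hw : (C.id (C.bang A) ⊠ w) ⋆ (C.dcirc A ⊠ C.id A) =
      (C.dcirc A ⊠ C.id A) ⋆ ((C.id (C.bang A) ⊠ C.id A) ⊠ w) := by
    rw [← C.tHom_comp, ← C.tHom_comp, C.tHom_id, C.comp_id, C.comp_id, C.id_comp, C.id_comp]
  have hd : C.linField w ⊠ C.id A =
      (C.dcirc A ⊠ C.id A) ⋆ ((C.id (C.bang A) ⊠ w) ⊠ C.id A) ⋆ (C.der A ⊠ C.id A) := by
    rw [← C.tHom_comp, ← C.tHom_comp, C.comp_id, C.comp_id]; rfl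
  conv_lhs => unfold linField
  rw [C.comp_assoc, C.comp_assoc, C.der_dcirc, C.comp_add, C.comp_add, C.comp_id, hd]
  congr 1
  rw [← C.comp_assoc (C.id _ ⊠ w), hw, C.comp_assoc, ← C.comp_assoc _ (C.exch _ _ _),
    C.exch_natural, C.comp_assoc, ← C.comp_assoc (C.dcirc A ⊠ _), ← C.comp_assoc (C.dcirc A),
    C.dcirc_dcirc_exch, C.comp_assoc]

theorem linField_euler {A : C.Obj} (w : C.Hom A A) :
    C.linField w ⋆ C.euler A = C.euler A ⋆ C.linField w := by
  have h₁ : C.linField w ⋆ C.euler A =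
      (C.dcirc A ⋆ (C.linField w ⊠ C.id A) ⋆ C.der A) ⨢ C.linField w := by
    rw [euler, ← C.comp_assoc, C.linField_dcirc, C.add_comp, C.comp_assoc, C.comp_assoc]; rfl
  have h₂ : C.euler A ⋆ C.linField w =
      (C.dcirc A ⋆ (C.linField w ⊠ C.id A) ⋆ C.der A) ⨢ C.linField w := by
    rw [euler, C.comp_assoc, C.der_linField, C.comp_add]; rfl
  rw [h₁, h₂]

theorem der_bangMap_zero (A : C.Obj) :
    C.der A ⋆ C.bangMap (C.zero : C.Hom A A) = C.zero := by
  rw [← C.der_natural, C.tHom_zero_right, C.zero_comp]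

theorem bangMap_zero_dcirc (A : C.Obj) :
    C.bangMap (C.zero : C.Hom A A) ⋆ C.dcirc A = C.zero := by
  rw [C.dcirc_natural, C.tHom_zero_right, C.comp_zero]

theorem bangMap_zero_bangMap_zero (A : C.Obj) :
    C.bangMap (C.zero : C.Hom A A) ⋆ C.bangMap (C.zero : C.Hom A A) =
      C.bangMap (C.zero : C.Hom A A) := by
  rw [← C.bangMap_comp, C.comp_zero]

theorem linField_bangMap_zero {A : C.Obj} (w : C.Hom A A) :
    C.linField w ⋆ C.bangMap (C.zero : C.Hom A A) = C.zero := by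
  rw [linField, C.comp_assoc, C.comp_assoc, C.der_bangMap_zero, C.comp_zero, C.comp_zero]

theorem bangMap_zero_linField {A : C.Obj} (w : C.Hom A A) :
    C.bangMap (C.zero : C.Hom A A) ⋆ C.linField w = C.zero := by
  rw [linField, ← C.comp_assoc, C.bangMap_zero_dcirc, C.zero_comp]

theorem zero_add {A B : C.Obj} (f : C.Hom A B) : C.zero ⨢ f = f := by
  rw [C.add_comm, C.add_zero]

/-! ### The operators `K` and `J` -/

theorem K_eq (A : C.Obj) : C.K A = C.euler A ⨢ C.bangMap (C.zero : C.Hom A A) := rfl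

theorem J_eq (A : C.Obj) : C.J A = C.euler A ⨢ C.id (C.bang A) := rfl

theorem K_linField {A : C.Obj} (w : C.Hom A A) :
    C.K A ⋆ C.linField w = C.linField w ⋆ C.K A := by
  rw [K_eq, C.add_comp, C.comp_add, C.linField_euler, C.linField_bangMap_zero,
    C.bangMap_zero_linField]

theorem K_bangMap_zero (A : C.Obj) :
    C.K A ⋆ C.bangMap (C.zero : C.Hom A A) = C.bangMap (C.zero : C.Hom A A) := by
  rw [K_eq, C.add_comp, ← C.linField_id, C.linField_bangMap_zero, C.bangMap_zero_bangMap_zero,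
    C.zero_add]

theorem J_tHom_id (A : C.Obj) :
    C.J A ⊠ C.id A = (C.euler A ⊠ C.id A) ⨢ C.id (C.ten (C.bang A) A) := by
  rw [J_eq, C.tHom_add_left, C.tHom_id]

theorem der_euler (A : C.Obj) : C.der A ⋆ C.euler A = (C.J A ⊠ C.id A) ⋆ C.der A := by
  rw [← C.linField_id, C.der_linField, C.linField_id, C.J_tHom_id, C.add_comp, C.tHom_id]

theorem euler_dcirc (A : C.Obj) : C.euler A ⋆ C.dcirc A = C.dcirc A ⋆ (C.J A ⊠ C.id A) := by
  rw [← C.linField_id, C.linField_dcirc, C.linField_id, C.J_tHom_id, C.comp_add, C.tHom_id]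

theorem der_K (A : C.Obj) : C.der A ⋆ C.K A = (C.J A ⊠ C.id A) ⋆ C.der A := by
  rw [K_eq, C.comp_add, C.der_bangMap_zero, C.add_zero, C.der_euler]

theorem K_dcirc (A : C.Obj) : C.K A ⋆ C.dcirc A = C.dcirc A ⋆ (C.J A ⊠ C.id A) := by
  rw [K_eq, C.add_comp, C.bangMap_zero_dcirc, C.add_zero, C.euler_dcirc]

theorem euler_natural {A B : C.Obj} (f : C.Hom A B) :
    C.bangMap f ⋆ C.euler B = C.euler A ⋆ C.bangMap f := by
  rw [euler, euler, ← C.comp_assoc, C.dcirc_natural, C.comp_assoc, C.der_natural, C.comp_assoc]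

theorem J_natural {A B : C.Obj} (f : C.Hom A B) :
    C.bangMap f ⋆ C.J B = C.J A ⋆ C.bangMap f := by
  rw [J_eq, J_eq, C.comp_add, C.add_comp, C.euler_natural, C.comp_id, C.id_comp]

theorem euler_eps (A : C.Obj) : C.euler A ⋆ C.eps A = C.eps A := by
  have h : (C.id (C.bang A) ⊠ C.eps A) ⋆ (C.cunit A ⊠ C.id A) =
      (C.cunit A ⊠ C.id (C.bang A)) ⋆ (C.id C.unit ⊠ C.eps A) := by
    rw [← C.tHom_comp, ← C.tHom_comp, C.comp_id, C.comp_id, C.id_comp, C.id_comp]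
  rw [euler, C.comp_assoc, C.der_eps, dcirc, C.comp_assoc, ← C.comp_assoc (C.id _ ⊠ _), h,
    C.comp_assoc, C.unit_ten_natural, ← C.comp_assoc (C.cunit A ⊠ _), ← C.comp_assoc,
    C.cmul_counit_left, C.id_comp]

theorem euler_cunit (A : C.Obj) : C.euler A ⋆ C.cunit A = C.zero := by
  rw [euler, C.comp_assoc, C.der_cunit, C.comp_zero]

theorem euler_rho (A : C.Obj) : C.euler A ⋆ C.rho A = C.rho A ⋆ C.linField (C.euler A) := by
  have h₁ : C.euler A ⋆ C.rho A = C.cmul A ⋆ (C.rho A ⊠ C.euler A) ⋆ C.der (C.bang A) := by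
    have hε : (C.id (C.bang A) ⊠ C.eps A) ⋆ (C.cmul A ⊠ C.id A) =
        (C.cmul A ⊠ C.id (C.bang A)) ⋆ ((C.id (C.bang A) ⊠ C.id (C.bang A)) ⊠ C.eps A) := by
      rw [← C.tHom_comp, ← C.tHom_comp, C.tHom_id, C.comp_id, C.comp_id, C.id_comp, C.id_comp]
    have hc := C.cmul_coassoc A
    rw [← C.comp_assoc] at hc
    have hw : C.rho A ⊠ C.euler A = (C.id (C.bang A) ⊠ C.cmul A) ⋆
        (C.id (C.bang A) ⊠ (C.id (C.bang A) ⊠ C.eps A)) ⋆ (C.rho A ⊠ C.der A) := by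
      rw [← C.tHom_comp, ← C.tHom_comp, C.id_comp, C.id_comp, ← C.comp_assoc]; rfl
    rw [hw, C.comp_assoc, ← C.comp_assoc (C.cmul A), ← hc, euler, C.comp_assoc, C.der_rho, dcirc,
      C.comp_assoc, ← C.comp_assoc (C.id _ ⊠ _), hε, C.comp_assoc,
      ← C.comp_assoc ((C.id _ ⊠ C.id _) ⊠ _), C.assoc_natural]
    simp only [C.comp_assoc]
  rw [h₁, linField, dcirc, ← C.comp_assoc, ← C.comp_assoc, ← C.comp_assoc, ← C.comp_assoc,
    C.rho_cmul, C.comp_assoc (C.cmul A) _ (C.id _ ⊠ _), ← C.tHom_comp, C.rho_eps,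
    C.comp_assoc (C.cmul A) _ (C.id _ ⊠ _), ← C.tHom_comp, C.comp_id, C.comp_id, C.id_comp,
    C.comp_assoc]

/-! ### Inverting `J` from `K` -/

/-- The map `!!A → !A` given by `Δ (!ε ⊗ ε e)`. -/
def weaken (A : C.Obj) : C.Hom (C.bang (C.bang A)) (C.bang A) :=
  C.dcirc (C.bang A) ⋆ (C.bangMap (C.eps A) ⊠ C.cunit A) ⋆
    C.toSMCData.cHom (C.ten_unit (C.bang A))

theorem tHom_id_weaken {A : C.Obj} (f : C.Hom (C.bang (C.bang A)) (C.bang (C.bang A)))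
    (g : C.Hom (C.bang A) (C.bang A))
    (h : f ⋆ C.bangMap (C.eps A) = C.bangMap (C.eps A) ⋆ g) :
    C.dcirc (C.bang A) ⋆ (f ⊠ C.id (C.bang A)) ⋆ (C.bangMap (C.eps A) ⊠ C.cunit A) ⋆
      C.toSMCData.cHom (C.ten_unit (C.bang A)) = C.weaken A ⋆ g := by
  rw [weaken, C.comp_assoc, C.comp_assoc, ← C.ten_unit_natural, ← C.comp_assoc (f ⊠ _),
    ← C.comp_assoc (_ ⊠ C.cunit A), ← C.tHom_comp, ← C.tHom_comp, h, C.id_comp, C.comp_id]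

theorem rho_weaken (A : C.Obj) : C.rho A ⋆ C.weaken A = C.id (C.bang A) := by
  rw [weaken, dcirc, ← C.comp_assoc, ← C.comp_assoc (C.rho A), C.rho_cmul,
    C.comp_assoc (C.cmul A), ← C.tHom_comp, C.rho_eps, C.comp_assoc, ← C.comp_assoc (_ ⊠ C.id _), ← C.tHom_comp,
    C.comp_id, C.rho_bangMap_eps, C.id_comp, C.cmul_counit_right]

theorem K_weaken (A : C.Obj) : C.K (C.bang A) ⋆ C.weaken A = C.weaken A ⋆ C.J A := by
  rw [← C.tHom_id_weaken _ _ (C.J_natural (C.eps A)).symm, weaken, ← C.comp_assoc, C.K_dcirc,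
    C.comp_assoc]

theorem linField_euler_weaken (A : C.Obj) :
    C.linField (C.euler A) ⋆ C.weaken A = C.weaken A ⋆ C.euler A := by
  have h : C.linField (C.euler A) ⋆ C.bangMap (C.eps A) = C.bangMap (C.eps A) ⋆ C.euler A := by
    rw [linField, C.comp_assoc, C.comp_assoc, ← C.der_natural, ← C.comp_assoc (C.id _ ⊠ _),
      ← C.tHom_comp, C.euler_eps, C.id_comp, ← C.comp_assoc, ← C.dcirc_natural, C.comp_assoc]
    rfl
  rw [← C.tHom_id_weaken _ _ h, weaken, ← C.comp_assoc, C.linField_dcirc, C.add_comp,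
    C.comp_assoc, C.comp_assoc, ← C.comp_assoc (C.id _ ⊠ _), ← C.tHom_comp, C.euler_cunit,
    C.tHom_zero_right, C.zero_comp, C.comp_zero, C.add_zero]

theorem J_inverse_of_K_inverse {A : C.Obj} {k : C.Hom (C.bang (C.bang A)) (C.bang (C.bang A))}
    (hk : C.K (C.bang A) ⋆ k = C.id _) (hk' : k ⋆ C.K (C.bang A) = C.id _) :
    C.J A ⋆ C.rho A ⋆ k ⋆ C.weaken A = C.id (C.bang A) ∧
      (C.rho A ⋆ k ⋆ C.weaken A) ⋆ C.J A = C.id (C.bang A) := by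
  have hleft : (C.rho A ⋆ k ⋆ C.weaken A) ⋆ C.J A = C.id (C.bang A) := by
    rw [C.comp_assoc, C.comp_assoc, ← C.K_weaken, ← C.comp_assoc k, hk', C.id_comp, C.rho_weaken]
  have hcomm : C.linField (C.euler A) ⋆ k = k ⋆ C.linField (C.euler A) := by
    rw [← C.id_comp (C.linField _ ⋆ k), ← hk', C.comp_assoc, ← C.comp_assoc (C.K _),
      C.K_linField, C.comp_assoc, hk, C.comp_id]
  have heuler : C.euler A ⋆ C.rho A ⋆ k ⋆ C.weaken A =
      (C.rho A ⋆ k ⋆ C.weaken A) ⋆ C.euler A := by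
    rw [← C.comp_assoc, C.euler_rho, C.comp_assoc, ← C.comp_assoc _ k, hcomm, C.comp_assoc,
      C.linField_euler_weaken, C.comp_assoc, C.comp_assoc]
  refine ⟨?_, hleft⟩
  rw [← hleft, J_eq, C.add_comp, C.comp_add, heuler, C.id_comp, C.comp_id]

theorem taylor_of_K_inverse {A B : C.Obj} {k : C.Hom (C.bang A) (C.bang A)}
    (hk : k ⋆ C.K A = C.id _) {f g : C.Hom (C.bang A) B} (h : C.der A ⋆ f = C.der A ⋆ g) :
    f ⨢ (C.bangMap (C.zero : C.Hom A A) ⋆ g) = g ⨢ (C.bangMap (C.zero : C.Hom A A) ⋆ f) := by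
  have hK : C.K A ⋆ (f ⨢ (C.bangMap (C.zero : C.Hom A A) ⋆ g)) =
      C.K A ⋆ (g ⨢ (C.bangMap (C.zero : C.Hom A A) ⋆ f)) := by
    rw [C.comp_add, C.comp_add, ← C.comp_assoc, ← C.comp_assoc, C.K_bangMap_zero, K_eq,
      C.add_comp, C.add_comp, euler, C.comp_assoc, C.comp_assoc, h, C.add_assoc, C.add_assoc,
      C.add_comm (_ ⋆ f)]
  rw [← C.id_comp (f ⨢ _), ← hk, C.comp_assoc, hK, ← C.comp_assoc, hk, C.id_comp]

/-! ### Inverting `K` from `J` -/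

theorem K_inverse_of_J_inverse {A : C.Obj} {j : C.Hom (C.bang A) (C.bang A)}
    (hj : C.J A ⋆ j = C.id _) (hj' : j ⋆ C.J A = C.id _)
    (taylor : ∀ f g : C.Hom (C.bang A) (C.bang A), C.der A ⋆ f = C.der A ⋆ g →
      f ⨢ (C.bangMap (C.zero : C.Hom A A) ⋆ g) = g ⨢ (C.bangMap (C.zero : C.Hom A A) ⋆ f)) :
    C.K A ⋆ ((C.dcirc A ⋆ ((j ⋆ j) ⊠ C.id A) ⋆ C.der A) ⨢ C.bangMap (C.zero : C.Hom A A)) =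
        C.id (C.bang A) ∧
      ((C.dcirc A ⋆ ((j ⋆ j) ⊠ C.id A) ⋆ C.der A) ⨢ C.bangMap (C.zero : C.Hom A A)) ⋆ C.K A =
        C.id (C.bang A) := by
  have hJj : (C.J A ⊠ C.id A) ⋆ (j ⊠ C.id A) = C.id _ := by
    rw [← C.tHom_comp, hj, C.comp_id, C.tHom_id]
  have hjJ : (j ⊠ C.id A) ⋆ (C.J A ⊠ C.id A) = C.id _ := by
    rw [← C.tHom_comp, hj', C.comp_id, C.tHom_id]
  have hjj : (j ⋆ j) ⊠ C.id A = (j ⊠ C.id A) ⋆ (j ⊠ C.id A) := by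
    rw [← C.tHom_comp, C.comp_id]
  have hder : C.der A ⋆ C.dcirc A ⋆ (j ⊠ C.id A) ⋆ C.der A = C.der A ⋆ C.id _ := by
    rw [← C.id_comp (C.der A ⋆ C.dcirc A ⋆ _), ← hjJ, C.comp_assoc, ← C.comp_assoc _ (C.der A),
      ← C.der_K, C.comp_assoc, ← C.comp_assoc (C.K A), C.K_dcirc, C.comp_assoc,
      ← C.comp_assoc (C.J A ⊠ _), hJj, C.id_comp]
    change _ ⋆ C.der A ⋆ C.euler A = _
    rw [C.der_euler, ← C.comp_assoc, hjJ, C.id_comp, C.comp_id]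
  have hsum : (C.dcirc A ⋆ (j ⊠ C.id A) ⋆ C.der A) ⨢ C.bangMap (C.zero : C.Hom A A) =
      C.id (C.bang A) := by
    have h := taylor _ _ hder
    rwa [C.comp_id, ← C.comp_assoc (C.bangMap _), C.bangMap_zero_dcirc, C.zero_comp,
      C.add_zero] at h
  constructor
  · rw [C.comp_add, C.K_bangMap_zero, ← C.comp_assoc, C.K_dcirc, hjj, C.comp_assoc, C.comp_assoc,
      ← C.comp_assoc (C.J A ⊠ _), hJj, C.id_comp, hsum]
  · have hzero : C.bangMap (C.zero : C.Hom A A) ⋆ C.K A = C.bangMap (C.zero : C.Hom A A) := by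
      rw [K_eq, C.comp_add, ← C.linField_id, C.bangMap_zero_linField,
        C.bangMap_zero_bangMap_zero, C.zero_add]
    rw [C.add_comp, hzero, C.comp_assoc, C.comp_assoc, C.der_K, hjj, C.comp_assoc,
      ← C.comp_assoc _ (C.J A ⊠ _), hjJ, C.id_comp, hsum]

end DiffCat

/-- Proposition 6.1 (Cockett–Lemay): K is a natural isomorphism iff
J is a natural isomorphism and the deriving transformation is Taylor. -/
theorem statement5 (C : DiffCat) :
    (∀ A : C.Obj, ∃ g : C.Hom (C.bang A) (C.bang A),
        C.comp (C.K A) g = C.id (C.bang A) ∧ C.comp g (C.K A) = C.id (C.bang A)) ↔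
    ((∀ A : C.Obj, ∃ g : C.Hom (C.bang A) (C.bang A),
        C.comp (C.J A) g = C.id (C.bang A) ∧ C.comp g (C.J A) = C.id (C.bang A)) ∧
      (∀ (A B : C.Obj) (f g : C.Hom (C.bang A) B),
        C.comp (C.der A) f = C.comp (C.der A) g →
          C.add f (C.comp (C.bangMap (C.zero : C.Hom A A)) g) =
            C.add g (C.comp (C.bangMap (C.zero : C.Hom A A)) f))) := by
  constructor
  · intro hK
    refine ⟨fun A => ?_, fun A B f g h => ?_⟩
    · obtain ⟨k, hk, hk'⟩ := hK (C.bang A)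
      exact ⟨_, C.J_inverse_of_K_inverse hk hk'⟩
    · obtain ⟨k, -, hk⟩ := hK A
      exact C.taylor_of_K_inverse hk h
  · rintro ⟨hJ, taylor⟩ A
    obtain ⟨j, hj, hj'⟩ := hJ A
    exact ⟨_, C.K_inverse_of_J_inverse hj hj' (taylor A _)⟩
end
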